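/- Let a, b > 0 and let u be the positive radial C² solution of the Kirchhoff equation -(a + b∫_{ℝ³}|∇u|² dx) Δu = u⁵ in ℝ³ with ∫_{ℝ³}|∇u|² dx < ∞ given by u(x) = Q(x/√c), where Q(x) = 3^{1/4}(1+|x|^2)^{-1/2}, k = ∫_{ℝ³}|∇Q|² dx, and √c = (1/2)(b·k + √(b²k² + 4a)). If φ : ℝ³ → ℝ is any C² function with ∫_{ℝ³}|∇φ|² dx < ∞ satisfying L₊φ = 0 pointwise on ℝ³, then there exist real constants λ₀, λ₁, λ₂, λ₃ such that φ(x) = λ₀(u(x)/2 + x·∇u(x)) + λ₁ ∂u/∂x₁(x) + λ₂ ∂u/∂x₂(x) + λ₃ ∂u/∂x₃(x) for all x ∈ ℝ³; conversely every such linear combination satisfies L₊φ = 0. In other words, Ker L₊ = span{u_{x₁}, u_{x₂}, u_{x₃}, u/2 + x·∇u}, so u is nondegenerate. -/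

import Mathlib

open MeasureTheory
open scoped RealInnerProductSpace

noncomputable section

/-- Euclidean space `ℝ³`. -/
abbrev R3 : Type := EuclideanSpace ℝ (Fin 3)

/-- The Laplacian `Δu = ∑ᵢ ∂²u/∂xᵢ²` on `ℝ³`. -/
noncomputable def lap (u : R3 → ℝ) (x : R3) : ℝ :=
  ∑ i : Fin 3,
    fderiv ℝ (fun y => fderiv ℝ u y (EuclideanSpace.single i 1)) x (EuclideanSpace.single i 1)

/-- The Aubin–Talenti bubble `Q(x) = 3^(1/4) (1 + |x|²)^(-1/2)` on `ℝ³`. -/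
noncomputable def Qb (x : R3) : ℝ := (3 : ℝ) ^ ((1 : ℝ) / 4) * (1 + ‖x‖ ^ 2) ^ (-(1 : ℝ) / 2)

/-- The surface measure on the unit sphere of `ℝ³`. -/
abbrev sphereMeasure : Measure (Metric.sphere (0 : R3) 1) := (volume : Measure R3).toSphere

lemma finrank_R3 : Module.finrank ℝ R3 = 3 := by simp

lemma polar_coordinates {f : R3 → ℝ} (hf : Integrable f) :
    IntegrableOn (fun r : ℝ => r ^ 2 * ∫ ω, f (r • (ω : R3)) ∂sphereMeasure) (Set.Ioi 0) ∧
      ∫ x, f x = ∫ r in Set.Ioi (0 : ℝ), r ^ 2 * ∫ ω, f (r • (ω : R3)) ∂sphereMeasure := by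
  have hmp := (volume : Measure R3).measurePreserving_homeomorphUnitSphereProd
  rw [finrank_R3] at hmp
  have hemb := (homeomorphUnitSphereProd R3).measurableEmbedding
  set g : Metric.sphere (0 : R3) 1 × Set.Ioi (0 : ℝ) → ℝ := fun p => f ((p.2 : ℝ) • (p.1 : R3))
    with hg
  have hgf : g ∘ homeomorphUnitSphereProd R3 = fun x : ({(0)}ᶜ : Set R3) => f x := by
    ext x
    have hx : ‖(x : R3)‖ ≠ 0 := norm_ne_zero_iff.2 fun h => x.2 h
    simp [hg, smul_smul, hx]
  have hfc : Integrable (fun x : ({(0)}ᶜ : Set R3) => f x) (volume.comap Subtype.val) := by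
    have := hf.integrableOn (s := ({(0)}ᶜ : Set R3))
    rwa [integrableOn_iff_comap_subtypeVal (by measurability)] at this
  have hgi : Integrable g (sphereMeasure.prod (.volumeIoiPow 2)) := by
    rw [← hmp.integrable_comp_emb hemb, hgf]
    exact hfc
  have key : ∀ h : ℝ → ℝ, ∫ r : Set.Ioi (0 : ℝ), h r ∂(Measure.volumeIoiPow 2)
      = ∫ r in Set.Ioi (0 : ℝ), r ^ 2 * h r := by
    intro h
    simp only [Measure.volumeIoiPow, ENNReal.ofReal]
    rw [integral_withDensity_eq_integral_smul,
      integral_subtype_comap measurableSet_Ioi fun a ↦ Real.toNNReal (a ^ 2) • h a,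
      setIntegral_congr_fun measurableSet_Ioi fun x hx ↦ ?_]
    · simp only [NNReal.smul_def, smul_eq_mul]
      rw [Real.coe_toNNReal _ (pow_nonneg (le_of_lt hx) _)]
    · exact (measurable_subtype_coe.pow_const _).real_toNNReal
  constructor
  · have h1 := hgi.integral_prod_right
    simp only [Measure.volumeIoiPow] at h1
    rw [integrable_withDensity_iff_integrable_smul' (by fun_prop) (by simp)] at h1
    rw [integrableOn_iff_comap_subtypeVal measurableSet_Ioi]
    refine h1.congr (.of_forall ?_)
    rintro ⟨x, hx : 0 < x⟩
    simp (disch := positivity) [ENNReal.toReal_ofReal, hg]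
  · rw [← key (fun r => ∫ ω, f (r • (ω : R3)) ∂sphereMeasure), ← integral_prod_symm _ hgi,
      ← hmp.integral_comp hemb]
    change _ = ∫ x, (g ∘ homeomorphUnitSphereProd R3) x ∂_
    rw [hgf, integral_subtype_comap (measurableSet_singleton _).compl fun x ↦ f x,
        restrict_compl_singleton]

lemma integrable_sphere_of_continuous {f : Metric.sphere (0 : R3) 1 → ℝ} (hf : Continuous f) :
    Integrable f sphereMeasure :=
  hf.integrable_of_hasCompactSupport (HasCompactSupport.of_compactSpace f)

lemma continuous_sphere_integral {H : ℝ → Metric.sphere (0 : R3) 1 → ℝ}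
    (hH : Continuous (Function.uncurry H)) :
    Continuous fun r => ∫ ω, H r ω ∂sphereMeasure := by
  have := continuous_parametric_integral_of_continuous (μ := sphereMeasure) hH isCompact_univ
  simpa using this

lemma hasDerivAt_sphere_integral {H H' : ℝ → Metric.sphere (0 : R3) 1 → ℝ}
    (hH : Continuous (Function.uncurry H)) (hH' : Continuous (Function.uncurry H'))
    (hd : ∀ r ω, HasDerivAt (fun s => H s ω) (H' r ω) r) (r : ℝ) :
    HasDerivAt (fun s => ∫ ω, H s ω ∂sphereMeasure) (∫ ω, H' r ω ∂sphereMeasure) r := by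
  obtain ⟨C, hC⟩ := ((isCompact_Icc (a := r - 1) (b := r + 1)).prod
    (isCompact_univ (X := Metric.sphere (0 : R3) 1))).exists_bound_of_continuousOn
      hH'.continuousOn
  refine (hasDerivAt_integral_of_dominated_loc_of_deriv_le (bound := fun _ => C)
    (Icc_mem_nhds (by linarith : r - 1 < r) (by linarith : r < r + 1)) ?_ ?_ ?_ ?_ ?_ ?_).2
  · exact .of_forall fun s =>
      (hH.comp (Continuous.prodMk_right s)).aestronglyMeasurable
  · exact integrable_sphere_of_continuous (hH.comp (Continuous.prodMk_right r))
  · exact (hH'.comp (Continuous.prodMk_right r)).aestronglyMeasurable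
  · exact .of_forall fun ω s hs => hC (s, ω) ⟨hs, Set.mem_univ _⟩
  · exact integrable_const _
  · exact .of_forall fun ω s _ => hd s ω

/-- The spherical moment `r ↦ ∫_{S²} f(rω) ⟪v, ω⟫ⁿ dω`. -/
def moment (f : R3 → ℝ) (v : R3) (n : ℕ) (r : ℝ) : ℝ :=
  ∫ ω, f (r • (ω : R3)) * ⟪v, (ω : R3)⟫ ^ n ∂sphereMeasure

/-- The first radial derivative of the spherical moment. -/
def momentDeriv (f : R3 → ℝ) (v : R3) (n : ℕ) (r : ℝ) : ℝ :=
  ∫ ω, fderiv ℝ f (r • (ω : R3)) ω * ⟪v, (ω : R3)⟫ ^ n ∂sphereMeasure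

/-- The second radial derivative of the spherical moment. -/
def momentDerivTwo (f : R3 → ℝ) (v : R3) (n : ℕ) (r : ℝ) : ℝ :=
  ∫ ω, fderiv ℝ (fderiv ℝ f) (r • (ω : R3)) ω ω * ⟪v, (ω : R3)⟫ ^ n ∂sphereMeasure

section moments

variable {f : R3 → ℝ} (v : R3) (n : ℕ)

lemma continuous_moment (hf : Continuous f) : Continuous (moment f v n) :=
  continuous_sphere_integral (by unfold Function.uncurry; fun_prop)

lemma hasDerivAt_moment (hf : ContDiff ℝ 1 f) (r : ℝ) :
    HasDerivAt (moment f v n) (momentDeriv f v n r) r := by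
  have h0 := hf.continuous
  have h1 := hf.continuous_fderiv one_ne_zero
  refine hasDerivAt_sphere_integral
    (H := fun r ω => f (r • (ω : R3)) * ⟪v, (ω : R3)⟫ ^ n)
    (H' := fun r ω => fderiv ℝ f (r • (ω : R3)) ω * ⟪v, (ω : R3)⟫ ^ n)
    (by unfold Function.uncurry; fun_prop) (by unfold Function.uncurry; fun_prop) (fun r ω => ?_) r
  refine HasDerivAt.mul_const ?_ _
  have hs : HasDerivAt (fun s : ℝ => s • (ω : R3)) (ω : R3) r := by
    simpa using (hasDerivAt_id r).smul_const (ω : R3)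
  exact (hf.differentiable one_ne_zero _).hasFDerivAt.comp_hasDerivAt r hs

lemma continuous_momentDeriv (hf : ContDiff ℝ 1 f) : Continuous (momentDeriv f v n) := by
  have h1 := hf.continuous_fderiv one_ne_zero
  exact continuous_sphere_integral (by unfold Function.uncurry; fun_prop)

lemma hasDerivAt_momentDeriv (hf : ContDiff ℝ 2 f) (r : ℝ) :
    HasDerivAt (momentDeriv f v n) (momentDerivTwo f v n r) r := by
  have hD : ContDiff ℝ 1 (fderiv ℝ f) := hf.fderiv_right (by norm_num)
  have h0 := hD.continuous
  have h1 := hD.continuous_fderiv one_ne_zero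
  refine hasDerivAt_sphere_integral
    (H := fun r ω => fderiv ℝ f (r • (ω : R3)) ω * ⟪v, (ω : R3)⟫ ^ n)
    (H' := fun r ω => fderiv ℝ (fderiv ℝ f) (r • (ω : R3)) ω ω * ⟪v, (ω : R3)⟫ ^ n)
    (by unfold Function.uncurry; fun_prop) (by unfold Function.uncurry; fun_prop) (fun r ω => ?_) r
  refine HasDerivAt.mul_const ?_ _
  have hs : HasDerivAt (fun s : ℝ => s • (ω : R3)) (ω : R3) r := by
    simpa using (hasDerivAt_id r).smul_const (ω : R3)
  have h2 : HasDerivAt (fun s : ℝ => fderiv ℝ f (s • (ω : R3)))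
      (fderiv ℝ (fderiv ℝ f) (r • (ω : R3)) ω) r :=
    (hD.differentiable one_ne_zero (r • (ω : R3))).hasFDerivAt.comp_hasDerivAt r hs
  simpa using h2.clm_apply (hasDerivAt_const r (ω : R3))

lemma continuous_momentDerivTwo (hf : ContDiff ℝ 2 f) : Continuous (momentDerivTwo f v n) := by
  have hD : ContDiff ℝ 1 (fderiv ℝ f) := hf.fderiv_right (by norm_num)
  have h1 := hD.continuous_fderiv one_ne_zero
  exact continuous_sphere_integral (by unfold Function.uncurry; fun_prop)

end moments

lemma integral_mul_fderiv_of_hasCompactSupport {f W : R3 → ℝ} (hf : ContDiff ℝ 1 f)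
    (hW : ContDiff ℝ 1 W) (hc : HasCompactSupport W) (v : R3) :
    ∫ x, f x * fderiv ℝ W x v = -∫ x, fderiv ℝ f x v * W x := by
  have hf0 := hf.continuous
  have hW0 := hW.continuous
  have hf1 := hf.continuous_fderiv one_ne_zero
  have hW1 := hW.continuous_fderiv one_ne_zero
  apply integral_mul_fderiv_eq_neg_fderiv_mul_of_integrable
  · exact (by fun_prop : Continuous _).integrable_of_hasCompactSupport hc.mul_left
  · exact (by fun_prop : Continuous _).integrable_of_hasCompactSupport
      ((hc.fderiv_apply ℝ v).mul_left)
  · exact (by fun_prop : Continuous _).integrable_of_hasCompactSupport hc.mul_left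
  · exact fun x _ => hf.differentiable one_ne_zero x
  · exact fun x _ => hW.differentiable one_ne_zero x

lemma integral_lap_mul {f W : R3 → ℝ} (hf : ContDiff ℝ 2 f)
    (hW : ContDiff ℝ 1 W) (hc : HasCompactSupport W) :
    ∫ x, lap f x * W x = -∫ x, ∑ i : Fin 3, fderiv ℝ f x (EuclideanSpace.single i 1) *
      fderiv ℝ W x (EuclideanSpace.single i 1) := by
  have hD : ContDiff ℝ 1 (fderiv ℝ f) := hf.fderiv_right (by norm_num)
  have hDi : ∀ i : Fin 3, ContDiff ℝ 1 fun x => fderiv ℝ f x (EuclideanSpace.single i 1) :=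
    fun i => hD.clm_apply contDiff_const
  have hW0 := hW.continuous
  have hf1 := hD.continuous
  have hW1 := hW.continuous_fderiv one_ne_zero
  have hDi1 := fun i => (hDi i).continuous_fderiv one_ne_zero
  simp only [lap, Finset.sum_mul]
  rw [integral_finsetSum, integral_finsetSum, ← Finset.sum_neg_distrib]
  · refine Finset.sum_congr rfl fun i _ => ?_
    rw [integral_mul_fderiv_of_hasCompactSupport (hDi i) hW hc, neg_neg]
  · exact fun i _ => (by fun_prop : Continuous _).integrable_of_hasCompactSupport
      ((hc.fderiv_apply ℝ _).mul_left)
  · intro i _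
    have := hDi1 i
    exact (by fun_prop : Continuous _).integrable_of_hasCompactSupport hc.mul_left

lemma sum_clm_single_mul_inner (L : R3 →L[ℝ] ℝ) (w : R3) :
    ∑ i : Fin 3, L (EuclideanSpace.single i 1) * ⟪w, EuclideanSpace.single i (1 : ℝ)⟫ = L w := by
  have hw : w = ∑ i : Fin 3, w i • EuclideanSpace.single i (1 : ℝ) := by
    ext j
    fin_cases j <;> simp [Fin.sum_univ_three]
  conv_rhs => rw [hw, map_sum]
  refine Finset.sum_congr rfl fun i _ => ?_
  simp [mul_comm, PiLp.inner_apply]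

lemma hasFDerivAt_inner_pow_mul_radial (v : R3) (n : ℕ) {g : ℝ → ℝ} (hg : Differentiable ℝ g)
    (x : R3) :
    HasFDerivAt (fun y : R3 => ⟪v, y⟫ ^ n * g (‖y‖ ^ 2))
      (((n : ℝ) * ⟪v, x⟫ ^ (n - 1) * g (‖x‖ ^ 2)) • innerSL ℝ v +
        (2 * ⟪v, x⟫ ^ n * deriv g (‖x‖ ^ 2)) • innerSL ℝ x) x := by
  have h1 : HasFDerivAt (fun y : R3 => ⟪v, y⟫) (innerSL ℝ v) x := (innerSL ℝ v).hasFDerivAt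
  have h2 := (hg (‖x‖ ^ 2)).hasDerivAt.comp_hasFDerivAt x (hasStrictFDerivAt_norm_sq x).hasFDerivAt
  refine ((h1.pow n).mul h2).congr_fderiv ?_
  ext h
  simp
  ring

lemma integral_weak_form {ψ : R3 → ℝ} (hψ : ContDiff ℝ 2 ψ) {V : ℝ → ℝ} (hV : Continuous V)
    (heq : ∀ x, lap ψ x + V (‖x‖ ^ 2) * ψ x = 0) (v : R3) (n : ℕ)
    {g : ℝ → ℝ} (hg : ContDiff ℝ 2 g) (hgc : HasCompactSupport fun x : R3 => g (‖x‖ ^ 2))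
    (hgc' : HasCompactSupport fun x : R3 => deriv g (‖x‖ ^ 2)) :
    ∫ x, (g (‖x‖ ^ 2) * (V (‖x‖ ^ 2) * ψ x * ⟪v, x⟫ ^ n
        + n * (n - 1 : ℕ) * ‖v‖ ^ 2 * (ψ x * ⟪v, x⟫ ^ (n - 2)))
      - 2 * deriv g (‖x‖ ^ 2) * (fderiv ℝ ψ x x * ⟪v, x⟫ ^ n - n * (ψ x * ⟪v, x⟫ ^ n))) = 0 := by
  have hψ1 : ContDiff ℝ 1 ψ := hψ.of_le (by norm_num)
  have hψ0 := hψ.continuous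
  have hDψ := hψ1.continuous_fderiv one_ne_zero
  have hgd := hg.differentiable two_ne_zero
  have hg0 := hg.continuous
  have hg'0 := hg.continuous_deriv (by norm_num)
  have hn : ContDiff ℝ 2 fun x : R3 => ‖x‖ ^ 2 := contDiff_norm_sq ℝ
  have hW : ∀ m : ℕ, ContDiff ℝ 1 fun x : R3 => ⟪v, x⟫ ^ m * g (‖x‖ ^ 2) := fun m =>
    ContDiff.of_le (((contDiff_const.inner ℝ contDiff_id).pow m).mul (hg.comp hn)) (by norm_num)
  have hWc : ∀ m : ℕ, HasCompactSupport fun x : R3 => ⟪v, x⟫ ^ m * g (‖x‖ ^ 2) :=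
    fun m => hgc.mul_left
  have e1 := integral_lap_mul hψ (hW n) (hWc n)
  have e2 := integral_mul_fderiv_of_hasCompactSupport hψ1 (hW (n - 1)) (hWc (n - 1)) v
  simp only [fun m x => (hasFDerivAt_inner_pow_mul_radial v m hgd x).fderiv] at e1 e2
  have e3 : ∀ x : R3, ∑ i : Fin 3, fderiv ℝ ψ x (EuclideanSpace.single i 1) *
      ((((n : ℝ) * ⟪v, x⟫ ^ (n - 1) * g (‖x‖ ^ 2)) • innerSL ℝ v +
        (2 * ⟪v, x⟫ ^ n * deriv g (‖x‖ ^ 2)) • innerSL ℝ x) (EuclideanSpace.single i 1))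
      = n * (fderiv ℝ ψ x v * (⟪v, x⟫ ^ (n - 1) * g (‖x‖ ^ 2))) +
        2 * deriv g (‖x‖ ^ 2) * (fderiv ℝ ψ x x * ⟪v, x⟫ ^ n) := by
    intro x
    rw [← sum_clm_single_mul_inner (fderiv ℝ ψ x) v]
    conv_rhs => rw [← sum_clm_single_mul_inner (fderiv ℝ ψ x) x]
    simp only [Finset.mul_sum, Finset.sum_mul, ← Finset.sum_add_distrib]
    refine Finset.sum_congr rfl fun i _ => ?_
    simp only [add_apply, smul_apply, innerSL_apply_apply,
      smul_eq_mul]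
    ring
  simp only [e3] at e1
  have i1 : Integrable fun x : R3 =>
      (n : ℝ) * (fderiv ℝ ψ x v * (⟪v, x⟫ ^ (n - 1) * g (‖x‖ ^ 2))) :=
    (by fun_prop : Continuous _).integrable_of_hasCompactSupport
      ((hWc (n - 1)).mul_left.mul_left)
  have i2 : Integrable fun x : R3 =>
      2 * deriv g (‖x‖ ^ 2) * (fderiv ℝ ψ x x * ⟪v, x⟫ ^ n) :=
    (by fun_prop : Continuous _).integrable_of_hasCompactSupport
      (hgc'.mul_left.mul_right)
  rw [integral_add i1 i2, integral_const_mul, ← neg_eq_iff_eq_neg.2 e2] at e1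
  have e4 : ∀ x, lap ψ x * (⟪v, x⟫ ^ n * g (‖x‖ ^ 2)) =
      - (g (‖x‖ ^ 2) * (V (‖x‖ ^ 2) * ψ x * ⟪v, x⟫ ^ n)) := by
    intro x
    linear_combination (⟪v, x⟫ ^ n * g (‖x‖ ^ 2)) * heq x
  simp only [e4] at e1
  have i3 : Integrable fun x : R3 => g (‖x‖ ^ 2) * (V (‖x‖ ^ 2) * ψ x * ⟪v, x⟫ ^ n) :=
    (by fun_prop : Continuous _).integrable_of_hasCompactSupport hgc.mul_right
  have i4 : Integrable fun x : R3 =>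
      g (‖x‖ ^ 2) * (n * (n - 1 : ℕ) * ‖v‖ ^ 2 * (ψ x * ⟪v, x⟫ ^ (n - 2))) :=
    (by fun_prop : Continuous _).integrable_of_hasCompactSupport hgc.mul_right
  have i5 : Integrable fun x : R3 => 2 * deriv g (‖x‖ ^ 2) * (n * (ψ x * ⟪v, x⟫ ^ n)) :=
    (by fun_prop : Continuous _).integrable_of_hasCompactSupport hgc'.mul_left.mul_right
  have e5 : ∀ x : R3, (n : ℝ) * (ψ x * ((((n - 1 : ℕ) : ℝ) * ⟪v, x⟫ ^ (n - 1 - 1) * g (‖x‖ ^ 2)) •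
      innerSL ℝ v + (2 * ⟪v, x⟫ ^ (n - 1) * deriv g (‖x‖ ^ 2)) • innerSL ℝ x) v) =
      g (‖x‖ ^ 2) * (n * (n - 1 : ℕ) * ‖v‖ ^ 2 * (ψ x * ⟪v, x⟫ ^ (n - 2))) +
      2 * deriv g (‖x‖ ^ 2) * (n * (ψ x * ⟪v, x⟫ ^ n)) := by
    intro x
    rw [Nat.sub_sub]
    simp only [add_apply, smul_apply, innerSL_apply_apply,
      smul_eq_mul, real_inner_self_eq_norm_sq, real_inner_comm v x]
    cases n with
    | zero => simp
    | succ m => simp only [Nat.add_sub_cancel]; ring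
  rw [mul_neg, ← integral_const_mul] at e1
  simp only [integral_neg, e5] at e1
  rw [integral_add i4 i5] at e1
  have : (∫ x, (g (‖x‖ ^ 2) * (V (‖x‖ ^ 2) * ψ x * ⟪v, x⟫ ^ n
        + n * (n - 1 : ℕ) * ‖v‖ ^ 2 * (ψ x * ⟪v, x⟫ ^ (n - 2)))
      - 2 * deriv g (‖x‖ ^ 2) * (fderiv ℝ ψ x x * ⟪v, x⟫ ^ n - n * (ψ x * ⟪v, x⟫ ^ n)))) =
      ∫ x, (((g (‖x‖ ^ 2) * (V (‖x‖ ^ 2) * ψ x * ⟪v, x⟫ ^ n)) +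
        (g (‖x‖ ^ 2) * (n * (n - 1 : ℕ) * ‖v‖ ^ 2 * (ψ x * ⟪v, x⟫ ^ (n - 2))))) -
        2 * deriv g (‖x‖ ^ 2) * (fderiv ℝ ψ x x * ⟪v, x⟫ ^ n)) +
        2 * deriv g (‖x‖ ^ 2) * (n * (ψ x * ⟪v, x⟫ ^ n)) := by
    congr 1
    ext x
    ring
  rw [this, integral_add _ i5, integral_sub _ i2, integral_add i3 i4]
  · linarith
  · exact i3.add i4
  · exact (i3.add i4).sub i2

lemma hasCompactSupport_comp_norm_sq {g : ℝ → ℝ} (hg : HasCompactSupport g) :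
    HasCompactSupport fun x : R3 => g (‖x‖ ^ 2) := by
  obtain ⟨R, hR⟩ := hg.isCompact.isBounded.subset_closedBall 0
  refine HasCompactSupport.intro (isCompact_closedBall (0 : R3) (|R| + 1)) fun x hx => ?_
  refine image_eq_zero_of_notMem_tsupport fun h => hx ?_
  have h1 := hR h
  simp only [Metric.mem_closedBall, dist_zero_right, Real.norm_eq_abs] at h1 ⊢
  rw [abs_of_nonneg (by positivity)] at h1
  by_contra! hlt
  nlinarith [le_abs_self R, abs_nonneg R]

lemma eq_zero_of_integral_Ioi_mul_eq_zero {D : ℝ → ℝ} (hD : Continuous D)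
    (h : ∀ g : ℝ → ℝ, ContDiff ℝ 2 g → HasCompactSupport g →
      ∫ r in Set.Ioi (0 : ℝ), g (r ^ 2) * D r = 0) {r : ℝ} (hr : 0 < r) : D r = 0 := by
  have main : ∀ {D : ℝ → ℝ}, Continuous D →
      (∀ g : ℝ → ℝ, ContDiff ℝ 2 g → HasCompactSupport g →
      ∫ r in Set.Ioi (0 : ℝ), g (r ^ 2) * D r = 0) → ¬ 0 < D r := by
    intro D hD h hpos
    obtain ⟨δ, hδ, hball⟩ := Metric.mem_nhds_iff.1
      (hD.continuousAt.eventually (lt_mem_nhds hpos))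
    let b : ContDiffBump (r ^ 2) := ⟨δ * r / 2, δ * r, by positivity, by linarith [mul_pos hδ hr]⟩
    have hb := h b b.contDiff b.hasCompactSupport
    have hcont : Continuous fun s => b (s ^ 2) * D s :=
      (b.continuous.comp (by fun_prop)).mul hD
    have hnn : ∀ s ∈ Set.Ioi (0 : ℝ), 0 ≤ b (s ^ 2) * D s := by
      intro s (hs : 0 < s)
      by_cases hsr : s ∈ Metric.ball r δ
      · exact mul_nonneg b.nonneg (hball hsr).le
      · rw [b.zero_of_le_dist, zero_mul]
        simp only [Metric.mem_ball, not_lt, Real.dist_eq] at hsr ⊢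
        have : s ^ 2 - r ^ 2 = (s - r) * (s + r) := by ring
        rw [this, abs_mul, abs_of_pos (by linarith : 0 < s + r)]
        exact mul_le_mul hsr (by linarith) hr.le (abs_nonneg _)
    have hint : IntegrableOn (fun s => b (s ^ 2) * D s) (Set.Ioi 0) := by
      have hc : HasCompactSupport fun s : ℝ => b (s ^ 2) * D s := by
        refine HasCompactSupport.intro (isCompact_closedBall r (r + r + r + δ)) fun s hs => ?_
        rw [b.zero_of_le_dist, zero_mul]
        simp only [Metric.mem_closedBall, not_le, Real.dist_eq] at hs ⊢
        have e : s ^ 2 - r ^ 2 = (s - r) * (s + r) := by ring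
        rw [e, abs_mul]
        have h2 : δ ≤ |s - r| := by linarith
        have h3 : r ≤ |s + r| := by
          have := abs_sub_abs_le_abs_sub (s - r) (-(r + r))
          rw [abs_neg, abs_of_pos (by linarith : 0 < r + r)] at this
          have e2 : s - r - -(r + r) = s + r := by ring
          rw [e2] at this
          linarith
        exact mul_le_mul h2 h3 hr.le (abs_nonneg _)
      exact (hcont.integrable_of_hasCompactSupport hc).integrableOn
    have h0 := (setIntegral_eq_zero_iff_of_nonneg_ae
      ((ae_restrict_iff' measurableSet_Ioi).2 (.of_forall hnn)) hint).1 hb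
    have h1 := Measure.eqOn_open_of_ae_eq h0 isOpen_Ioi hcont.continuousOn continuousOn_const
    have h2 := h1 (show r ∈ Set.Ioi 0 from hr)
    simp only [Pi.zero_apply] at h2
    rw [b.one_of_mem_closedBall (by simp [b.rIn_pos.le])] at h2
    linarith
  have h1 := main hD h
  have h2 := main hD.neg fun g hg hgc => by
    simp only [Pi.neg_apply, mul_neg, integral_neg, h g hg hgc, neg_zero]
  simp only [Pi.neg_apply] at h2
  linarith

lemma moment_ode {ψ : R3 → ℝ} (hψ : ContDiff ℝ 2 ψ) {V : ℝ → ℝ} (hV : Continuous V)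
    (heq : ∀ x, lap ψ x + V (‖x‖ ^ 2) * ψ x = 0) (v : R3) (n : ℕ) {r : ℝ} (hr : 0 < r) :
    r ^ 2 * momentDerivTwo ψ v n r + 2 * r * momentDeriv ψ v n r
      - n * (n + 1) * moment ψ v n r + r ^ 2 * V (r ^ 2) * moment ψ v n r
      + n * (n - 1 : ℕ) * ‖v‖ ^ 2 * moment ψ v (n - 2) r = 0 := by
  have hψ1 : ContDiff ℝ 1 ψ := hψ.of_le (by norm_num)
  have hψ0 := hψ.continuous
  have hDψ := hψ1.continuous_fderiv one_ne_zero
  have cm := fun m => continuous_moment v m hψ0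
  have cm1 := continuous_momentDeriv v n hψ1
  have cm2 := continuous_momentDerivTwo v n hψ
  set D : ℝ → ℝ := fun r => r ^ n * (r ^ 2 * momentDerivTwo ψ v n r + 2 * r * momentDeriv ψ v n r
      - n * (n + 1) * moment ψ v n r + r ^ 2 * V (r ^ 2) * moment ψ v n r
      + n * (n - 1 : ℕ) * ‖v‖ ^ 2 * moment ψ v (n - 2) r) with hDdef
  have hD : Continuous D := by fun_prop
  suffices D r = 0 by
    simpa [hDdef, hr.ne'] using this
  refine eq_zero_of_integral_Ioi_mul_eq_zero hD (fun g hg hgc => ?_) hr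
  have hg0 := hg.continuous
  have hg1 := hg.continuous_deriv (by norm_num)
  have hgc1 := hasCompactSupport_comp_norm_sq hgc
  have hgc2 := hasCompactSupport_comp_norm_sq hgc.deriv
  have hw := integral_weak_form hψ hV heq v n hg hgc1 hgc2
  have hwi : Integrable fun x : R3 => (g (‖x‖ ^ 2) * (V (‖x‖ ^ 2) * ψ x * ⟪v, x⟫ ^ n
        + n * (n - 1 : ℕ) * ‖v‖ ^ 2 * (ψ x * ⟪v, x⟫ ^ (n - 2)))
      - 2 * deriv g (‖x‖ ^ 2) * (fderiv ℝ ψ x x * ⟪v, x⟫ ^ n - n * (ψ x * ⟪v, x⟫ ^ n))) := by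
    refine (by fun_prop : Continuous _).integrable_of_hasCompactSupport ?_
    exact hgc1.mul_right.sub (hgc2.mul_left.mul_right)
  obtain ⟨hpi, hp⟩ := polar_coordinates hwi
  rw [hw] at hp
  have inner_eq : ∀ r : ℝ, (∫ ω, (g (‖r • (ω : R3)‖ ^ 2) * (V (‖r • (ω : R3)‖ ^ 2) *
          ψ (r • (ω : R3)) * ⟪v, r • (ω : R3)⟫ ^ n
        + n * (n - 1 : ℕ) * ‖v‖ ^ 2 * (ψ (r • (ω : R3)) * ⟪v, r • (ω : R3)⟫ ^ (n - 2)))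
      - 2 * deriv g (‖r • (ω : R3)‖ ^ 2) * (fderiv ℝ ψ (r • (ω : R3)) (r • (ω : R3)) *
          ⟪v, r • (ω : R3)⟫ ^ n - n * (ψ (r • (ω : R3)) * ⟪v, r • (ω : R3)⟫ ^ n))) ∂sphereMeasure)
      = g (r ^ 2) * (V (r ^ 2) * r ^ n * moment ψ v n r
        + n * (n - 1 : ℕ) * ‖v‖ ^ 2 * r ^ (n - 2) * moment ψ v (n - 2) r)
      - 2 * deriv g (r ^ 2) * r ^ n * (r * momentDeriv ψ v n r - n * moment ψ v n r) := by
    intro r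
    have hn : ∀ ω : Metric.sphere (0 : R3) 1, ‖r • (ω : R3)‖ ^ 2 = r ^ 2 := by
      intro ω
      rw [norm_smul, norm_eq_of_mem_sphere, mul_one, Real.norm_eq_abs, sq_abs]
    have i0 : ∀ m, Integrable (fun ω : Metric.sphere (0 : R3) 1 =>
        ψ (r • (ω : R3)) * ⟪v, (ω : R3)⟫ ^ m) sphereMeasure := fun m =>
      integrable_sphere_of_continuous (by fun_prop)
    have i1 : Integrable (fun ω : Metric.sphere (0 : R3) 1 =>
        fderiv ℝ ψ (r • (ω : R3)) ω * ⟪v, (ω : R3)⟫ ^ n) sphereMeasure :=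
      integrable_sphere_of_continuous (by fun_prop)
    have : ∀ ω : Metric.sphere (0 : R3) 1,
        (g (‖r • (ω : R3)‖ ^ 2) * (V (‖r • (ω : R3)‖ ^ 2) *
          ψ (r • (ω : R3)) * ⟪v, r • (ω : R3)⟫ ^ n
        + n * (n - 1 : ℕ) * ‖v‖ ^ 2 * (ψ (r • (ω : R3)) * ⟪v, r • (ω : R3)⟫ ^ (n - 2)))
      - 2 * deriv g (‖r • (ω : R3)‖ ^ 2) * (fderiv ℝ ψ (r • (ω : R3)) (r • (ω : R3)) *
          ⟪v, r • (ω : R3)⟫ ^ n - n * (ψ (r • (ω : R3)) * ⟪v, r • (ω : R3)⟫ ^ n))) =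
      (g (r ^ 2) * V (r ^ 2) * r ^ n + 2 * deriv g (r ^ 2) * r ^ n * n) *
          (ψ (r • (ω : R3)) * ⟪v, (ω : R3)⟫ ^ n)
        + (g (r ^ 2) * (n * (n - 1 : ℕ) * ‖v‖ ^ 2 * r ^ (n - 2))) *
          (ψ (r • (ω : R3)) * ⟪v, (ω : R3)⟫ ^ (n - 2))
        - 2 * deriv g (r ^ 2) * r ^ n * r *
          (fderiv ℝ ψ (r • (ω : R3)) ω * ⟪v, (ω : R3)⟫ ^ n) := by
      intro ω
      rw [hn, inner_smul_right, map_smul, smul_eq_mul]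
      ring
    simp only [this]
    rw [integral_sub ?_ (i1.const_mul _), integral_add ((i0 n).const_mul _)
      ((i0 (n - 2)).const_mul _), integral_const_mul, integral_const_mul, integral_const_mul]
    swap
    · exact ((i0 n).const_mul _).add ((i0 (n - 2)).const_mul _)
    simp only [moment, momentDeriv]
    ring
  simp only [inner_eq] at hp hpi
  set N : ℝ → ℝ := fun r => r ^ (n + 1) * (r * momentDeriv ψ v n r - n * moment ψ v n r) with hN
  set N' : ℝ → ℝ := fun r => r ^ n * (r ^ 2 * momentDerivTwo ψ v n r + 2 * r * momentDeriv ψ v n r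
      - n * (n + 1) * moment ψ v n r) with hN'
  have hNd : ∀ s, HasDerivAt (fun r => g (r ^ 2) * N r)
      (2 * s * deriv g (s ^ 2) * N s + g (s ^ 2) * N' s) s := by
    intro s
    have h1 : HasDerivAt (fun r : ℝ => g (r ^ 2)) (2 * s * deriv g (s ^ 2)) s := by
      have := (hg.differentiable two_ne_zero (s ^ 2)).hasDerivAt.comp s (hasDerivAt_pow 2 s)
      refine this.congr_deriv ?_
      simp
      ring
    have h2 : HasDerivAt N (N' s) s := by
      have := (hasDerivAt_pow (n + 1) s).mul
        (((hasDerivAt_id s).mul (hasDerivAt_momentDeriv v n hψ s)).sub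
          ((hasDerivAt_moment v n hψ1 s).const_mul (n : ℝ)))
      refine this.congr_deriv ?_
      simp [hN']
      ring
    exact h1.mul h2
  have hNc : Continuous N := by fun_prop
  have hN'c : Continuous N' := by fun_prop
  have hcs : ∀ {g : ℝ → ℝ}, HasCompactSupport g → HasCompactSupport fun r : ℝ => g (r ^ 2) := by
    intro g hgc
    have := (hasCompactSupport_comp_norm_sq hgc).comp_isClosedEmbedding
      (LinearIsometry.toSpanSingleton ℝ R3 (v := EuclideanSpace.single 0 1)
        (by simp)).isometry.isClosedEmbedding
    simpa [Function.comp_def, norm_smul] using this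
  have hint : IntegrableOn (fun s => 2 * s * deriv g (s ^ 2) * N s + g (s ^ 2) * N' s)
      (Set.Ioi 0) := by
    refine Integrable.integrableOn ?_
    exact (by fun_prop : Continuous _).integrable_of_hasCompactSupport
      ((hcs hgc.deriv).mul_left.mul_right.add (hcs hgc).mul_right)
  have hlim : Filter.Tendsto (fun r => g (r ^ 2) * N r) Filter.atTop (nhds 0) := by
    have : HasCompactSupport fun r => g (r ^ 2) * N r := (hcs hgc).mul_right
    exact (this.is_zero_at_infty).mono_left atTop_le_cocompact
  have hftc := integral_Ioi_of_hasDerivAt_of_tendsto' (a := 0) (fun s _ => hNd s) hint hlim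
  have hN0 : N 0 = 0 := by simp [hN]
  rw [hN0, mul_zero, sub_zero] at hftc
  have hsum := integral_add hpi hint
  rw [← hp, hftc, add_zero] at hsum
  refine Eq.trans (integral_congr_ae (.of_forall fun s => ?_)) hsum
  have hpow : (n : ℝ) * (n - 1 : ℕ) * s ^ n = n * (n - 1 : ℕ) * (s ^ (n - 2) * s ^ 2) := by
    rcases n with _ | _ | m
    · simp
    · simp
    · rw [show m + 1 + 1 - 2 = m from rfl]
      ring
  simp only [hDdef, hN, hN']
  linear_combination (g (s ^ 2) * ‖v‖ ^ 2 * moment ψ v (n - 2) s) * hpow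

lemma eq_zero_of_hasDerivAt_eq_zero {f : ℝ → ℝ} (hc : Continuous f) (h0 : f 0 = 0)
    (hd : ∀ r, 0 < r → HasDerivAt f 0 r) {r : ℝ} (hr : 0 ≤ r) : f r = 0 := by
  rcases hr.eq_or_lt with rfl | hr
  · exact h0
  obtain ⟨x, hx, hx'⟩ := exists_hasDerivAt_eq_slope f 0 hr hc.continuousOn
    fun x hx => hd x hx.1
  rw [h0, sub_zero, sub_zero, Pi.zero_apply, eq_comm, div_eq_zero_iff] at hx'
  exact hx'.resolve_right hr.ne'

/-- A regular solution of the radial equation of angular degree zero with vanishing Cauchy data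
at the origin is zero. -/
lemma radial_zero_of_degree_zero {c : ℝ} (hc : 0 < c) {F F' F'' : ℝ → ℝ}
    (hF : ∀ r, HasDerivAt F (F' r) r) (hF' : ∀ r, HasDerivAt F' (F'' r) r)
    (hode : ∀ r, 0 < r → r ^ 2 * F'' r + 2 * r * F' r + r ^ 2 * (15 * c / (c + r ^ 2) ^ 2) * F r = 0)
    (h0 : F 0 = 0) (h1 : F' 0 = 0) {r : ℝ} (hr : 0 < r) : F r = 0 := by
  set E : ℝ → ℝ := fun r => F' r ^ 2 + 15 * c / (c + r ^ 2) ^ 2 * F r ^ 2 with hE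
  have hpos : ∀ s : ℝ, 0 < c + s ^ 2 := fun s => by positivity
  have hd : ∀ s, HasDerivAt E (2 * F' s * F'' s + ((-60 * c * s / (c + s ^ 2) ^ 3) * F s ^ 2 +
      15 * c / (c + s ^ 2) ^ 2 * (2 * F s * F' s))) s := by
    intro s
    have hm : HasDerivAt (fun s : ℝ => c + s ^ 2) (2 * s) s := by
      simpa using (hasDerivAt_pow 2 s).const_add c
    have := ((hF' s).pow 2).add ((((hm.pow 2).inv (pow_ne_zero 2 (hpos s).ne')).const_mul
      (15 * c)).mul ((hF s).pow 2))
    refine HasDerivAt.congr_deriv (this.congr_of_eventuallyEq (.of_forall fun s => ?_)) ?_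
    · simp [hE, div_eq_mul_inv]
    · have := (hpos s).ne'
      simp
      field_simp
      ring
  have hanti : AntitoneOn E (Set.Ici 0) := by
    refine antitoneOn_of_deriv_nonpos (convex_Ici 0)
      (fun s _ => (hd s).continuousAt.continuousWithinAt)
      (fun s _ => (hd s).differentiableAt.differentiableWithinAt) fun s hs => ?_
    rw [interior_Ici, Set.mem_Ioi] at hs
    rw [(hd s).deriv]
    have ho := hode s hs
    have e : 2 * F' s * F'' s + ((-60 * c * s / (c + s ^ 2) ^ 3) * F s ^ 2 +
      15 * c / (c + s ^ 2) ^ 2 * (2 * F s * F' s)) =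
        -(4 * F' s ^ 2 / s) - 60 * c * s / (c + s ^ 2) ^ 3 * F s ^ 2 := by
      have : F'' s = - 2 * F' s / s - 15 * c / (c + s ^ 2) ^ 2 * F s := by
        refine mul_left_cancel₀ (pow_ne_zero 2 hs.ne') ?_
        have e : s ^ 2 * (-2 * F' s / s - 15 * c / (c + s ^ 2) ^ 2 * F s) =
            -2 * s * F' s - s ^ 2 * (15 * c / (c + s ^ 2) ^ 2) * F s := by
          field_simp
        linarith
      rw [this]
      ring
    rw [e]
    have h2 : 0 ≤ 4 * F' s ^ 2 / s := by positivity
    have h3 : 0 ≤ 60 * c * s / (c + s ^ 2) ^ 3 * F s ^ 2 := by positivity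
    linarith
  have h2 := hanti (Set.mem_Ici.2 le_rfl) (Set.mem_Ici.2 hr.le) hr.le
  have hE0 : E 0 = 0 := by simp [hE, h0, h1]
  rw [hE0] at h2
  have h3 : 0 < 15 * c / (c + r ^ 2) ^ 2 := by have := hpos r; positivity
  by_contra hne
  have h4 : 0 < 15 * c / (c + r ^ 2) ^ 2 * F r ^ 2 := by positivity
  have h5 : E r = F' r ^ 2 + 15 * c / (c + r ^ 2) ^ 2 * F r ^ 2 := rfl
  nlinarith [sq_nonneg (F' r)]

/-- A regular solution of the radial equation of angular degree one with vanishing Cauchy data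
at the origin is zero. -/
lemma radial_zero_of_degree_one {c : ℝ} (hc : 0 < c) {F F' F'' : ℝ → ℝ}
    (hF : ∀ r, HasDerivAt F (F' r) r) (hF' : ∀ r, HasDerivAt F' (F'' r) r)
    (hode : ∀ r, 0 < r → r ^ 2 * F'' r + 2 * r * F' r - 2 * F r
      + r ^ 2 * (15 * c / (c + r ^ 2) ^ 2) * F r = 0)
    (h0 : F 0 = 0) (h1 : F' 0 = 0) {r : ℝ} (hr : 0 < r) : F r = 0 := by
  have hpos : ∀ s : ℝ, 0 < c + s ^ 2 := fun s => by positivity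
  have hm : ∀ s : ℝ, HasDerivAt (fun s : ℝ => c + s ^ 2) (2 * s) s := fun s => by
    simpa using (hasDerivAt_pow 2 s).const_add c
  set P : ℝ → ℝ := fun r => r * (c + r ^ 2) * F' r - (c - 2 * r ^ 2) * F r with hP
  have hPd : ∀ s, HasDerivAt P (s * (c + s ^ 2) * F'' s + (5 * s ^ 2) * F' s + 4 * s * F s) s := by
    intro s
    have := (((hasDerivAt_id s).mul (hm s)).mul (hF' s)).sub
      ((((hasDerivAt_pow 2 s).const_mul 2).const_sub c).mul (hF s))
    refine this.congr_deriv ?_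
    simp
    ring
  have hP0 : ∀ s, 0 ≤ s → P s ^ 2 * s ^ 4 / (c + s ^ 2) ^ 5 = 0 := by
    intro s hs
    have hd : ∀ t, HasDerivAt (fun s => P s ^ 2 * s ^ 4 / (c + s ^ 2) ^ 5) _ t := fun t =>
      (((hPd t).pow 2).mul (hasDerivAt_pow 4 t)).div ((hm t).pow 5) (pow_ne_zero 5 (hpos t).ne')
    refine eq_zero_of_hasDerivAt_eq_zero
      (continuous_iff_continuousAt.2 fun t => (hd t).continuousAt) (by simp) (fun t ht => ?_) hs
    refine (hd t).congr_deriv ?_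
    have ho := hode t ht
    have e : F'' t = - 2 * F' t / t + 2 * F t / t ^ 2 - 15 * c / (c + t ^ 2) ^ 2 * F t := by
      have := (hpos t).ne'
      field_simp at ho ⊢
      linarith
    have := (hpos t).ne'
    refine div_eq_zero_iff.2 (.inl ?_)
    simp only [Pi.pow_apply, Pi.mul_apply, hP, e]
    push_cast
    field_simp
    ring
  have hP1 : ∀ s, 0 < s → P s = 0 := by
    intro s hs
    have := hP0 s hs.le
    have h2 := (hpos s).ne'
    simpa [hs.ne', h2] using this
  by_contra hne
  set W : ℝ → ℝ := fun s => F s ^ 2 * (c + s ^ 2) ^ 3 / s ^ 2 with hW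
  have hWd : ∀ s, 0 < s → HasDerivAt W 0 s := by
    intro s hs
    have := (((hF s).pow 2).mul ((hm s).pow 3)).div (hasDerivAt_pow 2 s) (pow_ne_zero 2 hs.ne')
    refine this.congr_deriv ?_
    have e := hP1 s hs
    simp only [hP] at e
    refine div_eq_zero_iff.2 (.inl ?_)
    simp only [Pi.pow_apply, Pi.mul_apply]
    push_cast
    linear_combination 2 * F s * (c + s ^ 2) ^ 2 * s * e
  have hWc : ∀ s, 0 < s → W s = W r := by
    intro s hs
    exact (isOpen_Ioi.is_const_of_deriv_eq_zero isPreconnected_Ioi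
      (fun x hx => (hWd x hx).differentiableAt.differentiableWithinAt)
      (fun x hx => (hWd x hx).deriv) hs hr)
  have hlim : Filter.Tendsto W (nhdsWithin 0 (Set.Ioi 0)) (nhds 0) := by
    have h2 := (hasDerivAt_iff_tendsto_slope_zero.1 (hF 0))
    have h3 : Filter.Tendsto (fun t => t⁻¹ • (F (0 + t) - F 0)) (nhdsWithin 0 (Set.Ioi 0))
      (nhds 0) := by
      rw [h1] at h2
      exact h2.mono_left (nhdsWithin_mono _ fun x hx => ne_of_gt hx)
    have h4 : Filter.Tendsto (fun t : ℝ => (c + t ^ 2) ^ 3) (nhdsWithin 0 (Set.Ioi 0))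
        (nhds ((c + 0 ^ 2) ^ 3)) :=
      ((by fun_prop : Continuous fun t : ℝ => (c + t ^ 2) ^ 3).tendsto 0).mono_left
        nhdsWithin_le_nhds
    have h5 := (h3.pow 2).mul h4
    simp only [ne_eq, OfNat.ofNat_ne_zero, not_false_eq_true, zero_pow, zero_mul] at h5
    refine h5.congr fun t => ?_
    simp only [zero_add, h0, sub_zero, smul_eq_mul, hW]
    ring
  have hconst : Filter.Tendsto W (nhdsWithin 0 (Set.Ioi 0)) (nhds (W r)) :=
    tendsto_const_nhds.congr' (Filter.eventuallyEq_of_mem self_mem_nhdsWithin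
      fun s hs => (hWc s hs).symm)
  have := tendsto_nhds_unique hconst hlim
  have h2 := (hpos r).ne'
  simp [hW, hr.ne', h2, hne] at this

/-- A bounded regular solution of the radial equation of angular degree at least two is zero. -/
lemma radial_zero_of_two_le_degree {c : ℝ} (hc : 0 < c) {ℓ : ℝ} (hℓ : 6 ≤ ℓ) {F F' F'' : ℝ → ℝ}
    (hF : ∀ r, HasDerivAt F (F' r) r) (hF' : ∀ r, HasDerivAt F' (F'' r) r)
    (hode : ∀ r, 0 < r → r ^ 2 * F'' r + 2 * r * F' r - ℓ * F r
      + r ^ 2 * (15 * c / (c + r ^ 2) ^ 2) * F r = 0)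
    {B : ℝ} (hB : ∀ r, 1 ≤ r → |F r| ≤ B) {r : ℝ} (hr : 0 < r) : F r = 0 := by
  have hpos : ∀ s : ℝ, 0 < c + s ^ 2 := fun s => by positivity
  set G : ℝ → ℝ := fun r => r ^ 2 * (F r * F' r) with hG
  have hGd : ∀ s, HasDerivAt G (2 * s * (F s * F' s) + s ^ 2 * (F' s * F' s + F s * F'' s)) s := by
    intro s
    have := (hasDerivAt_pow 2 s).mul ((hF s).mul (hF' s))
    refine this.congr_deriv ?_
    simp
  have hVle : ∀ s : ℝ, s ^ 2 * (15 * c / (c + s ^ 2) ^ 2) ≤ 15 / 4 := by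
    intro s
    rw [mul_div_assoc', div_le_div_iff₀ (by have := hpos s; positivity) (by norm_num)]
    nlinarith [sq_nonneg (c - s ^ 2)]
  have hGle : ∀ s, 0 < s → F s ^ 2 ≤
      2 * s * (F s * F' s) + s ^ 2 * (F' s * F' s + F s * F'' s) := by
    intro s hs
    have ho := hode s hs
    have e : 2 * s * (F s * F' s) + s ^ 2 * (F' s * F' s + F s * F'' s) =
        s ^ 2 * F' s ^ 2 + (ℓ - s ^ 2 * (15 * c / (c + s ^ 2) ^ 2)) * F s ^ 2 := by
      linear_combination F s * ho
    rw [e]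
    nlinarith [hVle s, sq_nonneg (F s), sq_nonneg (s * F' s)]
  have hGmono : MonotoneOn G (Set.Ici 0) := by
    refine monotoneOn_of_deriv_nonneg (convex_Ici 0)
      (fun s _ => (hGd s).continuousAt.continuousWithinAt)
      (fun s _ => (hGd s).differentiableAt.differentiableWithinAt) fun s hs => ?_
    rw [interior_Ici, Set.mem_Ioi] at hs
    rw [(hGd s).deriv]
    exact (sq_nonneg _).trans (hGle s hs)
  have hG0 : ∀ s, 0 ≤ s → 0 ≤ G s := by
    intro s hs
    have := hGmono (Set.mem_Ici.2 le_rfl) (Set.mem_Ici.2 hs) hs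
    simpa [hG] using this
  have hF2d : ∀ s, HasDerivAt (fun s => F s ^ 2) (2 * (F s * F' s)) s := by
    intro s
    refine ((hF s).pow 2).congr_deriv ?_
    simp
    ring
  have hF2 : MonotoneOn (fun s => F s ^ 2) (Set.Ici 0) := by
    refine monotoneOn_of_deriv_nonneg (convex_Ici 0)
      (fun s _ => (hF2d s).continuousAt.continuousWithinAt)
      (fun s _ => (hF2d s).differentiableAt.differentiableWithinAt) fun s hs => ?_
    rw [interior_Ici, Set.mem_Ioi] at hs
    rw [(hF2d s).deriv]
    have := hG0 s hs.le
    simp only [hG] at this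
    have h3 : 0 ≤ F s * F' s := by
      by_contra! hlt
      nlinarith [mul_neg_of_pos_of_neg (pow_pos hs 2) hlt]
    linarith
  by_contra hne
  set d := F r ^ 2 with hd
  have hdpos : 0 < d := by positivity
  have hGlow : ∀ s, r ≤ s → d * (s - r) ≤ G s := by
    intro s hs
    have hmono : MonotoneOn (fun s => G s - d * (s - r)) (Set.Ici r) := by
      have hdd : ∀ t, HasDerivAt (fun s => G s - d * (s - r))
          (2 * t * (F t * F' t) + t ^ 2 * (F' t * F' t + F t * F'' t) - d * 1) t := fun t =>
        (hGd t).sub (((hasDerivAt_id t).sub_const r).const_mul d)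
      refine monotoneOn_of_deriv_nonneg (convex_Ici r)
        (fun t _ => (hdd t).continuousAt.continuousWithinAt)
        (fun t _ => (hdd t).differentiableAt.differentiableWithinAt) fun t ht => ?_
      rw [interior_Ici, Set.mem_Ioi] at ht
      rw [(hdd t).deriv]
      have h2 := hF2 (Set.mem_Ici.2 hr.le) (Set.mem_Ici.2 (hr.trans ht).le) ht.le
      have h3 := hGle t (hr.trans ht)
      simp only at h2
      linarith
    have h2 := hmono (Set.mem_Ici.2 le_rfl) (Set.mem_Ici.2 hs) hs
    have h3 := hG0 r hr.le
    simp only [sub_self, mul_zero, sub_zero] at h2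
    linarith
  have hgrow : MonotoneOn (fun s => F s ^ 2 - d * Real.log s) (Set.Ici (2 * r)) := by
    have hdd : ∀ t, 0 < t → HasDerivAt (fun s => F s ^ 2 - d * Real.log s)
        (2 * (F t * F' t) - d * t⁻¹) t := fun t ht =>
      (hF2d t).sub ((Real.hasDerivAt_log ht.ne').const_mul d)
    refine monotoneOn_of_deriv_nonneg (convex_Ici _)
        (fun t ht => (hdd t (by linarith [Set.mem_Ici.1 ht])).continuousAt.continuousWithinAt)
        (fun t ht => (hdd t ?_).differentiableAt.differentiableWithinAt) fun t ht => ?_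
    · rw [interior_Ici, Set.mem_Ioi] at ht
      linarith
    · rw [interior_Ici, Set.mem_Ioi] at ht
      have ht0 : 0 < t := by linarith
      rw [(hdd t ht0).deriv]
      have h2 := hGlow t (by linarith)
      simp only [hG] at h2
      have h3 : d * t ≤ 2 * (t ^ 2 * (F t * F' t)) := by nlinarith
      have h4 : d * t⁻¹ = d * t / t ^ 2 := by field_simp
      rw [h4, sub_nonneg, div_le_iff₀ (by positivity)]
      linarith
  have hlog : Filter.Tendsto (fun s => d * Real.log s) Filter.atTop Filter.atTop :=
    Real.tendsto_log_atTop.const_mul_atTop hdpos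
  obtain ⟨s, hs1, hs2, hs3⟩ := ((hlog.eventually_gt_atTop
    (B ^ 2 - (F (2 * r) ^ 2 - d * Real.log (2 * r)))).and
    ((Filter.eventually_ge_atTop 1).and (Filter.eventually_ge_atTop (2 * r)))).exists
  have h2 := hgrow (Set.mem_Ici.2 le_rfl) (Set.mem_Ici.2 hs3) hs3
  have h3 := hB s hs2
  have h4 : F s ^ 2 ≤ B ^ 2 := sq_le_sq' (by linarith [neg_abs_le (F s)]) (by linarith [le_abs_self (F s)])
  simp only at h2
  linarith

lemma moment_eq_zero {ψ : R3 → ℝ} (hψ : ContDiff ℝ 2 ψ) {c : ℝ} (hc : 0 < c)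
    (heq : ∀ x, lap ψ x + 15 * c / (c + ‖x‖ ^ 2) ^ 2 * ψ x = 0)
    (h0 : ψ 0 = 0) (h1 : fderiv ℝ ψ 0 = 0)
    (hB : ∀ v n, ∃ B, ∀ r, 1 ≤ r → |moment ψ v n r| ≤ B) (v : R3) (n : ℕ) :
    ∀ r, 0 < r → moment ψ v n r = 0 := by
  have hV : Continuous fun t : ℝ => 15 * c / (c + |t|) ^ 2 :=
    continuous_const.div (by fun_prop) fun t => by positivity
  have hψ1 : ContDiff ℝ 1 ψ := hψ.of_le (by norm_num)
  have habs : ∀ t : ℝ, |t ^ 2| = t ^ 2 := fun t => abs_of_nonneg (sq_nonneg t)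
  have ode := fun (n : ℕ) (r : ℝ) (hr : 0 < r) =>
    moment_ode hψ hV (by simpa only [habs] using heq) v n hr
  simp only [habs] at ode
  have hz : ∀ n, moment ψ v n 0 = 0 := fun n => by simp [moment, h0]
  have hz1 : ∀ n, momentDeriv ψ v n 0 = 0 := fun n => by simp [momentDeriv, h1]
  induction n using Nat.strong_induction_on with
  | _ n ih =>
    intro r hr
    have hF := hasDerivAt_moment v n hψ1
    have hF' := hasDerivAt_momentDeriv v n hψ
    rcases n with _ | _ | m
    · refine radial_zero_of_degree_zero hc hF hF' (fun r hr => ?_) (hz 0) (hz1 0) hr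
      have := ode 0 r hr
      simpa using this
    · refine radial_zero_of_degree_one hc hF hF' (fun r hr => ?_) (hz _) (hz1 _) hr
      have := ode 1 r hr
      norm_num at this
      simpa using this
    · obtain ⟨B, hB⟩ := hB v (m + 2)
      refine radial_zero_of_two_le_degree hc (ℓ := ((m : ℝ) + 2) * (m + 3)) ?_ hF hF'
        (fun r hr => ?_) hB hr
      · have : (0 : ℝ) ≤ m := by positivity
        nlinarith
      · have := ode (m + 2) r hr
        rw [Nat.add_sub_cancel, ih m (by omega) r hr] at this
        push_cast at this
        linear_combination this

lemma eq_zero_of_integral_mul_inner_pow_eq_zero {f : R3 → ℝ} (hf : Continuous f)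
    (hfc : HasCompactSupport f) (h : ∀ v n, ∫ x, f x * ⟪v, x⟫ ^ n = 0) (x : R3) : f x = 0 := by
  obtain ⟨R, hR⟩ := hfc.isCompact.isBounded.subset_closedBall 0
  have hfi : Integrable f := hf.integrable_of_hasCompactSupport hfc
  set F : R3 → ℂ := fun x => (f x : ℂ) with hF
  have hFc : Continuous F := Complex.continuous_ofReal.comp hf
  have hFi : Integrable F := hfi.ofReal
  have hzero : FourierTransform.fourier F = 0 := by
    ext w
    rw [Real.fourier_eq']
    set T : ℕ → R3 → ℂ := fun n x =>
      ((-2 * Real.pi * Complex.I) ^ n / (n.factorial : ℂ)) * ((f x * ⟪w, x⟫ ^ n : ℝ) : ℂ) with hT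
    have hTi : ∀ n, Integrable (T n) := fun n => by
      have hi : Integrable fun x : R3 => f x * ⟪w, x⟫ ^ n :=
        (by fun_prop : Continuous _).integrable_of_hasCompactSupport hfc.mul_right
      exact hi.ofReal.const_mul _
    have hbound : ∀ n x, ‖T n x‖ ≤ |f x| * ((2 * Real.pi * (‖w‖ * |R|)) ^ n / n.factorial) := by
      intro n x
      by_cases hx : f x = 0
      · simp [hT, hx]
      · have hxR : ‖x‖ ≤ |R| := by
          have := hR (subset_tsupport f hx)
          simp only [Metric.mem_closedBall, dist_zero_right] at this
          exact this.trans (le_abs_self R)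
        have h1 : |⟪w, x⟫| ≤ ‖w‖ * |R| := (abs_real_inner_le_norm w x).trans (by gcongr)
        simp only [hT, norm_mul, norm_div, norm_pow, norm_neg, Complex.norm_I, Complex.norm_ofNat,
          Complex.norm_real, Real.norm_eq_abs, abs_of_pos Real.pi_pos, Complex.norm_natCast, mul_one,
          Complex.ofReal_mul, Complex.ofReal_pow]
        rw [mul_pow _ (‖w‖ * |R|)]
        calc _ = |f x| * ((2 * Real.pi) ^ n * |⟪w, x⟫| ^ n / n.factorial) := by ring
          _ ≤ _ := by gcongr
    have hsum := hasSum_integral_of_summable_integral_norm hTi (by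
      refine Summable.of_nonneg_of_le (fun n => integral_nonneg fun _ => norm_nonneg _)
        (fun n => integral_mono (hTi n).norm (hfi.abs.mul_const _) (hbound n)) ?_
      simp only [integral_mul_const]
      exact (Real.summable_pow_div_factorial _).mul_left _)
    have hT0 : ∀ n, ∫ x, T n x = 0 := fun n => by
      simp only [hT]
      rw [integral_const_mul, integral_complex_ofReal, h w n]
      simp
    simp only [hT0] at hsum
    rw [Pi.zero_apply, ← hsum.unique hasSum_zero]
    refine integral_congr_ae (.of_forall fun x => ?_)
    have hexp := (NormedSpace.expSeries_div_hasSum_exp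
      ((-2 * Real.pi * ⟪x, w⟫ : ℝ) * Complex.I)).mul_right (f x : ℂ)
    rw [← Complex.exp_eq_exp_ℂ] at hexp
    simp only [smul_eq_mul, hF]
    rw [← hexp.tsum_eq]
    refine tsum_congr fun n => ?_
    simp only [hT, real_inner_comm]
    push_cast
    ring
  have hinv := hFc.fourierInv_fourier_eq hFi (by rw [hzero]; exact integrable_zero _ _ _)
  have h2 := congrFun hinv x
  rw [hzero, Real.fourierInv_eq] at h2
  simpa [hF] using h2.symm

lemma eq_zero_of_moment_eq_zero {ψ : R3 → ℝ} (hψ : Continuous ψ)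
    (h : ∀ v n r, 0 < r → moment ψ v n r = 0) (x : R3) : ψ x = 0 := by
  set f : R3 → ℝ := fun y => max 0 (‖x‖ ^ 2 + 1 - ‖y‖ ^ 2) * ψ y with hf
  have hfc : HasCompactSupport f := by
    refine HasCompactSupport.intro (isCompact_closedBall (0 : R3) (‖x‖ + 1)) fun y hy => ?_
    simp only [Metric.mem_closedBall, dist_zero_right, not_le] at hy
    have : ‖x‖ ^ 2 + 1 - ‖y‖ ^ 2 ≤ 0 := by nlinarith [norm_nonneg x]
    simp [hf, max_eq_left this]
  have hf0 : Continuous f := by fun_prop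
  have := eq_zero_of_integral_mul_inner_pow_eq_zero hf0 hfc (fun v n => ?_) x
  · simpa [hf] using this
  · have hi : Integrable fun y : R3 => f y * ⟪v, y⟫ ^ n :=
      (by fun_prop : Continuous _).integrable_of_hasCompactSupport hfc.mul_right
    rw [(polar_coordinates hi).2]
    refine setIntegral_eq_zero_of_forall_eq_zero fun r (hr : 0 < r) => ?_
    have e : ∀ ω : Metric.sphere (0 : R3) 1, f (r • (ω : R3)) * ⟪v, r • (ω : R3)⟫ ^ n =
        max 0 (‖x‖ ^ 2 + 1 - r ^ 2) * r ^ n * (ψ (r • (ω : R3)) * ⟪v, (ω : R3)⟫ ^ n) := by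
      intro ω
      have : ‖r • (ω : R3)‖ = r := by
        rw [norm_smul, norm_eq_of_mem_sphere, mul_one, Real.norm_eq_abs, abs_of_pos hr]
      simp only [hf, this, inner_smul_right]
      ring
    simp only [e]
    rw [integral_const_mul]
    have := h v n r hr
    rw [moment] at this
    rw [this, mul_zero, mul_zero]

lemma norm_gradient_eq_norm_fderiv (f : R3 → ℝ) (x : R3) : ‖gradient f x‖ = ‖fderiv ℝ f x‖ := by
  rw [gradient, LinearIsometryEquiv.norm_map]

lemma abs_moment_le {f : R3 → ℝ} {C : ℝ} (hf : ∀ x, |f x| ≤ C) (v : R3) (n : ℕ) (r : ℝ) :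
    |moment f v n r| ≤ C * ‖v‖ ^ n * sphereMeasure.real Set.univ := by
  have hC : 0 ≤ C := (abs_nonneg _).trans (hf 0)
  rw [moment, ← Real.norm_eq_abs]
  refine norm_integral_le_of_norm_le_const (.of_forall fun ω => ?_)
  rw [norm_mul, norm_pow, Real.norm_eq_abs]
  have : ‖⟪v, (ω : R3)⟫‖ ≤ ‖v‖ := by
    simpa using norm_inner_le_norm (𝕜 := ℝ) v (ω : R3)
  gcongr
  exact hf _

lemma exists_abs_moment_le {f : R3 → ℝ} (hf : ContDiff ℝ 1 f)
    (hi : Integrable fun x : R3 => ‖gradient f x‖ ^ 2) (v : R3) (n : ℕ) :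
    ∃ B, ∀ r, 1 ≤ r → |moment f v n r| ≤ B := by
  simp only [norm_gradient_eq_norm_fderiv] at hi
  have hD := hf.continuous_fderiv one_ne_zero
  set S := sphereMeasure.real Set.univ with hS
  set h : ℝ → ℝ := fun r => ‖v‖ ^ n / 2 *
    (r ^ 2 * (∫ ω, ‖fderiv ℝ f (r • (ω : R3))‖ ^ 2 ∂sphereMeasure) + S * r ^ (-2 : ℝ)) with hh
  have hhi : IntegrableOn h (Set.Ioi 1) := by
    refine Integrable.const_mul (Integrable.add ?_ (Integrable.const_mul ?_ _)) _
    · exact (polar_coordinates hi).1.mono_set (Set.Ioi_subset_Ioi zero_le_one)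
    · exact integrableOn_Ioi_rpow_of_lt (by norm_num) one_pos
  have hbound : ∀ r, 1 ≤ r → |momentDeriv f v n r| ≤ h r := by
    intro r hr
    have hr0 : 0 < r := by linarith
    have hi2 : Integrable (fun ω : Metric.sphere (0 : R3) 1 =>
        ‖fderiv ℝ f (r • (ω : R3))‖ ^ 2) sphereMeasure :=
      integrable_sphere_of_continuous (by fun_prop)
    have e : h r = ∫ ω, ‖v‖ ^ n / 2 * (r ^ 2 * ‖fderiv ℝ f (r • (ω : R3))‖ ^ 2 + r ^ (-2 : ℝ))
        ∂sphereMeasure := by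
      rw [integral_const_mul, integral_add (hi2.const_mul _) (integrable_const _),
        integral_const_mul, integral_const, smul_eq_mul]
    rw [e, momentDeriv, ← Real.norm_eq_abs]
    refine norm_integral_le_of_norm_le (((hi2.const_mul _).add (integrable_const _)).const_mul _)
      (.of_forall fun ω => ?_)
    rw [norm_mul, norm_pow]
    have h1 : ‖⟪v, (ω : R3)⟫‖ ≤ ‖v‖ := by
      simpa using norm_inner_le_norm (𝕜 := ℝ) v (ω : R3)
    have h2 : ‖fderiv ℝ f (r • (ω : R3)) ω‖ ≤ ‖fderiv ℝ f (r • (ω : R3))‖ := by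
      simpa using (fderiv ℝ f (r • (ω : R3))).le_opNorm ω
    have h3 : ‖fderiv ℝ f (r • (ω : R3))‖ ≤
        (r ^ 2 * ‖fderiv ℝ f (r • (ω : R3))‖ ^ 2 + r ^ (-2 : ℝ)) / 2 := by
      set t := ‖fderiv ℝ f (r • (ω : R3))‖
      have e2 : r ^ (-2 : ℝ) = (r⁻¹) ^ 2 := by
        rw [Real.rpow_neg hr0.le, inv_pow]
        norm_num
      have e3 : r * r⁻¹ = 1 := mul_inv_cancel₀ hr0.ne'
      rw [e2]
      have e4 : r ^ 2 * t ^ 2 + r⁻¹ ^ 2 = (r * t - r⁻¹) ^ 2 + 2 * t := by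
        linear_combination 2 * t * e3
      rw [e4]
      linarith [sq_nonneg (r * t - r⁻¹)]
    calc _ ≤ ((r ^ 2 * ‖fderiv ℝ f (r • (ω : R3))‖ ^ 2 + r ^ (-2 : ℝ)) / 2) * ‖v‖ ^ n := by
            gcongr
            exact h2.trans h3
      _ = _ := by ring
  refine ⟨|moment f v n 1| + ∫ s in Set.Ioi 1, h s, fun r hr => ?_⟩
  have hFTC := intervalIntegral.integral_eq_sub_of_hasDerivAt (a := 1) (b := r)
    (fun s _ => hasDerivAt_moment v n hf s)
    ((continuous_momentDeriv v n hf).intervalIntegrable _ _)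
  have h1 : |∫ s in (1 : ℝ)..r, momentDeriv f v n s| ≤ ∫ s in Set.Ioi 1, h s := by
    rw [intervalIntegral.integral_of_le hr, ← Real.norm_eq_abs]
    refine (norm_integral_le_of_norm_le (hhi.mono_set Set.Ioc_subset_Ioi_self)
      ((ae_restrict_iff' measurableSet_Ioc).2 (.of_forall fun s hs => hbound s hs.1.le))).trans ?_
    refine setIntegral_mono_set hhi ?_ (.of_forall Set.Ioc_subset_Ioi_self)
    exact (ae_restrict_iff' measurableSet_Ioi).2 (.of_forall fun s hs =>
      (abs_nonneg _).trans (hbound s (Set.mem_Ioi.1 hs).le))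
  rw [hFTC] at h1
  have := abs_sub_abs_le_abs_sub (moment f v n r) (moment f v n 1)
  linarith

/-- The function `(c + |x|²)^p (γ + δ|x|² + ⟪w, x⟫)` on `ℝ³`. -/
def powMulQuad (c p γ δ : ℝ) (w x : R3) : ℝ :=
  (c + ‖x‖ ^ 2) ^ p * (γ + δ * ‖x‖ ^ 2 + ⟪w, x⟫)

section powMulQuad

variable {c : ℝ} (hc : 0 < c) (p γ δ : ℝ) (w : R3)
include hc

lemma contDiff_powMulQuad {n : WithTop ℕ∞} : ContDiff ℝ n (powMulQuad c p γ δ w) := by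
  have h : ContDiff ℝ n fun x : R3 => ‖x‖ ^ 2 := contDiff_norm_sq ℝ
  refine ContDiff.mul ?_ ?_
  · exact (contDiff_const.add h).rpow_const_of_ne fun x => by positivity
  · exact (contDiff_const.add (contDiff_const.mul h)).add (contDiff_const.inner ℝ contDiff_id)

lemma hasFDerivAt_powMulQuad (x : R3) :
    HasFDerivAt (powMulQuad c p γ δ w)
      ((2 * p * (c + ‖x‖ ^ 2) ^ (p - 1) * (γ + δ * ‖x‖ ^ 2 + ⟪w, x⟫)
        + 2 * δ * (c + ‖x‖ ^ 2) ^ p) • innerSL ℝ x + (c + ‖x‖ ^ 2) ^ p • innerSL ℝ w) x := by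
  have h : HasFDerivAt (fun x : R3 => ‖x‖ ^ 2) (2 • innerSL ℝ x) x :=
    (hasStrictFDerivAt_norm_sq x).hasFDerivAt
  have h1 := (h.const_add c).rpow_const (p := p) (.inl (by positivity))
  have h2 := ((h.const_mul δ).const_add γ).add (innerSL ℝ w).hasFDerivAt
  refine (h1.mul h2).congr_fderiv ?_
  ext v
  simp
  ring

lemma fderiv_powMulQuad (x v : R3) :
    fderiv ℝ (powMulQuad c p γ δ w) x v =
      (2 * p * (c + ‖x‖ ^ 2) ^ (p - 1) * (γ + δ * ‖x‖ ^ 2 + ⟪w, x⟫)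
        + 2 * δ * (c + ‖x‖ ^ 2) ^ p) * ⟪x, v⟫ + (c + ‖x‖ ^ 2) ^ p * ⟪w, v⟫ := by
  rw [(hasFDerivAt_powMulQuad hc p γ δ w x).fderiv]
  simp

lemma gradient_powMulQuad (x : R3) :
    gradient (powMulQuad c p γ δ w) x =
      (2 * p * (c + ‖x‖ ^ 2) ^ (p - 1) * (γ + δ * ‖x‖ ^ 2 + ⟪w, x⟫)
        + 2 * δ * (c + ‖x‖ ^ 2) ^ p) • x + (c + ‖x‖ ^ 2) ^ p • w := by
  refine ext_inner_right ℝ fun v => ?_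
  rw [gradient, InnerProductSpace.toDual_symm_apply, fderiv_powMulQuad hc]
  simp [inner_add_left, inner_smul_left]

lemma lap_powMulQuad (x : R3) :
    lap (powMulQuad c p γ δ w) x =
      (6 * p * (c + ‖x‖ ^ 2) ^ (p - 1) + 4 * p * (p - 1) * ‖x‖ ^ 2 * (c + ‖x‖ ^ 2) ^ (p - 2)) *
        (γ + δ * ‖x‖ ^ 2 + ⟪w, x⟫) +
      4 * p * (c + ‖x‖ ^ 2) ^ (p - 1) * (2 * δ * ‖x‖ ^ 2 + ⟪w, x⟫) +
      6 * δ * (c + ‖x‖ ^ 2) ^ p := by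
  simp only [lap, fderiv_powMulQuad hc]
  have h1 : ∀ e : R3, fderiv ℝ (fun y : R3 =>
      (2 * p * (c + ‖y‖ ^ 2) ^ (p - 1) * (γ + δ * ‖y‖ ^ 2 + ⟪w, y⟫)
        + 2 * δ * (c + ‖y‖ ^ 2) ^ p) * ⟪y, e⟫ + (c + ‖y‖ ^ 2) ^ p * ⟪w, e⟫) x e =
      (4 * p * (p - 1) * (c + ‖x‖ ^ 2) ^ (p - 2) * (γ + δ * ‖x‖ ^ 2 + ⟪w, x⟫)
        + 8 * p * δ * (c + ‖x‖ ^ 2) ^ (p - 1)) * ⟪x, e⟫ ^ 2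
      + 4 * p * (c + ‖x‖ ^ 2) ^ (p - 1) * (⟪x, e⟫ * ⟪w, e⟫)
      + (2 * p * (c + ‖x‖ ^ 2) ^ (p - 1) * (γ + δ * ‖x‖ ^ 2 + ⟪w, x⟫)
        + 2 * δ * (c + ‖x‖ ^ 2) ^ p) * ⟪e, e⟫ := by
    intro e
    have hA := hasFDerivAt_powMulQuad hc (p - 1) γ δ w x
    have hB := hasFDerivAt_powMulQuad hc p 1 0 0 x
    have hI : HasFDerivAt (fun y : R3 => ⟪y, e⟫) (innerSL ℝ e) x := by
      simp only [real_inner_comm e]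
      exact (innerSL ℝ e).hasFDerivAt
    have := ((((hA.const_mul (2 * p)).add (hB.const_mul (2 * δ))).mul hI).add
      (hB.mul_const ⟪w, e⟫)).fderiv
    have e2 : (fun y : R3 =>
      (2 * p * (c + ‖y‖ ^ 2) ^ (p - 1) * (γ + δ * ‖y‖ ^ 2 + ⟪w, y⟫)
        + 2 * δ * (c + ‖y‖ ^ 2) ^ p) * ⟪y, e⟫ + (c + ‖y‖ ^ 2) ^ p * ⟪w, e⟫) =
        (((fun y => 2 * p * powMulQuad c (p - 1) γ δ w y) + fun y => 2 * δ * powMulQuad c p 1 0 0 y)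
          * (fun y => ⟪y, e⟫)) + fun y => powMulQuad c p 1 0 0 y * ⟪w, e⟫ := by
      ext y
      simp only [powMulQuad, Pi.add_apply, Pi.mul_apply, inner_zero_left]
      ring
    rw [e2, this]
    have e3 : p - 1 - 1 = p - 2 := by ring
    simp [powMulQuad, e3]
    ring
  simp only [h1]
  simp only [Finset.sum_add_distrib, ← Finset.mul_sum]
  have s1 : ∑ i : Fin 3, ⟪x, EuclideanSpace.single i (1 : ℝ)⟫ ^ 2 = ‖x‖ ^ 2 := by
    simp [EuclideanSpace.norm_sq_eq, PiLp.inner_apply]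
  have s2 : ∑ i : Fin 3, ⟪x, EuclideanSpace.single i (1 : ℝ)⟫ *
      ⟪w, EuclideanSpace.single i (1 : ℝ)⟫ = ⟪w, x⟫ := by
    simp [PiLp.inner_apply]
  have s3 : ∑ i : Fin 3, ⟪EuclideanSpace.single i (1 : ℝ), EuclideanSpace.single i (1 : ℝ)⟫ =
      (3 : ℝ) := by
    simp
  rw [s1, s2, s3]
  ring

end powMulQuad

lemma lap_sub {f g : R3 → ℝ} (hf : ContDiff ℝ 2 f) (hg : ContDiff ℝ 2 g) (x : R3) :
    lap (fun y => f y - g y) x = lap f x - lap g x := by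
  have h1 : ∀ {f : R3 → ℝ}, ContDiff ℝ 2 f → ∀ v, Differentiable ℝ fun x => fderiv ℝ f x v :=
    fun hf v => ((hf.fderiv_right (m := 1) (by norm_num)).clm_apply contDiff_const).differentiable
      one_ne_zero
  simp only [lap, ← Finset.sum_sub_distrib]
  refine Finset.sum_congr rfl fun i _ => ?_
  rw [← sub_apply,
    ← fderiv_sub (h1 hf _ x) (h1 hg _ x)]
  congr 2
  ext y
  rw [Pi.sub_apply, ← sub_apply, ← fderiv_sub
    (hf.differentiable two_ne_zero y) (hg.differentiable two_ne_zero y)]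
  rfl

lemma lap_const_mul {f : R3 → ℝ} (hf : ContDiff ℝ 2 f) (a : ℝ) (x : R3) :
    lap (fun y => a * f y) x = a * lap f x := by
  have h1 : ∀ v, Differentiable ℝ fun x => fderiv ℝ f x v :=
    fun v => ((hf.fderiv_right (m := 1) (by norm_num)).clm_apply contDiff_const).differentiable
      one_ne_zero
  simp only [lap, Finset.mul_sum]
  refine Finset.sum_congr rfl fun i _ => ?_
  simp only [fderiv_const_mul (hf.differentiable two_ne_zero _)]
  simp only [smul_apply, smul_eq_mul]
  rw [fderiv_const_mul (h1 _ x)]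
  simp

lemma rpow_neg_half_pow {m : ℝ} (hm : 0 < m) :
    m ^ (-(3 / 2 : ℝ)) = (m ^ (-(1 / 2 : ℝ))) ^ 3 ∧ m ^ (-(5 / 2 : ℝ)) = (m ^ (-(1 / 2 : ℝ))) ^ 5 ∧
      m ^ (-(7 / 2 : ℝ)) = (m ^ (-(1 / 2 : ℝ))) ^ 7 ∧ (m ^ (-(1 / 2 : ℝ))) ^ 2 * m = 1 := by
  refine ⟨?_, ?_, ?_, ?_⟩
  any_goals
    rw [← Real.rpow_natCast, ← Real.rpow_mul hm.le]
    norm_num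
  rw [Real.rpow_neg_one, inv_mul_cancel₀ hm.ne']

section bubble

variable {c : ℝ} (hc : 0 < c)
include hc

lemma lap_bubble (x : R3) :
    lap (powMulQuad c (-(1 / 2)) 1 0 0) x = -3 * c * ((c + ‖x‖ ^ 2) ^ (-(1 / 2 : ℝ))) ^ 5 := by
  obtain ⟨h3, h5, h7, h1⟩ := rpow_neg_half_pow (m := c + ‖x‖ ^ 2) (by positivity)
  rw [lap_powMulQuad hc, show (-(1 / 2) - 1 : ℝ) = -(3 / 2) by norm_num,
    show (-(1 / 2) - 2 : ℝ) = -(5 / 2) by norm_num, h3, h5, inner_zero_left]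
  linear_combination 3 * ((c + ‖x‖ ^ 2) ^ (-(1 / 2 : ℝ))) ^ 3 * h1

lemma lap_bubble_kernel (β : ℝ) (w x : R3) :
    lap (powMulQuad c (-(3 / 2)) (c * β) (-β) w) x +
      15 * c / (c + ‖x‖ ^ 2) ^ 2 * powMulQuad c (-(3 / 2)) (c * β) (-β) w x = 0 := by
  have hm : 0 < c + ‖x‖ ^ 2 := by positivity
  obtain ⟨h3, h5, h7, h1⟩ := rpow_neg_half_pow hm
  have h2 : 15 * c / (c + ‖x‖ ^ 2) ^ 2 = 15 * c * ((c + ‖x‖ ^ 2) ^ (-(1 / 2 : ℝ))) ^ 4 := by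
    rw [div_eq_iff (by positivity)]
    linear_combination
      (-15 * c * (((c + ‖x‖ ^ 2) ^ (-(1 / 2 : ℝ))) ^ 2 * (c + ‖x‖ ^ 2) + 1)) * h1
  rw [lap_powMulQuad hc, powMulQuad, h2, show (-(3 / 2) - 1 : ℝ) = -(5 / 2) by norm_num,
    show (-(3 / 2) - 2 : ℝ) = -(7 / 2) by norm_num, h3, h5, h7]
  linear_combination (15 * ((c + ‖x‖ ^ 2) ^ (-(1 / 2 : ℝ))) ^ 5 *
    (c * β + -β * ‖x‖ ^ 2 + ⟪w, x⟫) + 6 * β * ((c + ‖x‖ ^ 2) ^ (-(1 / 2 : ℝ))) ^ 3) * h1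

lemma bubble_bounded (x : R3) : |powMulQuad c (-(1 / 2)) 1 0 0 x| ≤ c ^ (-(1 / 2 : ℝ)) := by
  have hm : 0 < c + ‖x‖ ^ 2 := by positivity
  simp only [powMulQuad, zero_mul, inner_zero_left, add_zero, mul_one]
  rw [abs_of_pos (Real.rpow_pos_of_pos hm _)]
  exact Real.rpow_le_rpow_of_nonpos hc (by nlinarith [norm_nonneg x]) (by norm_num)

lemma norm_le_mul_add_norm_sq (x : R3) : ‖x‖ ≤ (1 + c⁻¹) * (c + ‖x‖ ^ 2) := by
  have h1 : c⁻¹ * c = 1 := inv_mul_cancel₀ hc.ne'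
  have h2 : 0 ≤ c⁻¹ * ‖x‖ ^ 2 := by positivity
  nlinarith [sq_nonneg (‖x‖ - 1)]

lemma bubble_kernel_bounded (β : ℝ) (w x : R3) :
    |powMulQuad c (-(3 / 2)) (c * β) (-β) w x| ≤
      (|β| + ‖w‖ * (1 + c⁻¹)) * c ^ (-(1 / 2 : ℝ)) := by
  have hm : 0 < c + ‖x‖ ^ 2 := by positivity
  obtain ⟨h3, h5, h7, h1⟩ := rpow_neg_half_pow hm
  have hb : (c + ‖x‖ ^ 2) ^ (-(1 / 2 : ℝ)) ≤ c ^ (-(1 / 2 : ℝ)) :=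
    Real.rpow_le_rpow_of_nonpos hc (by nlinarith [norm_nonneg x]) (by norm_num)
  have ht := Real.rpow_pos_of_pos hm (-(1 / 2))
  rw [powMulQuad, h3, abs_mul, abs_of_pos (pow_pos ht 3)]
  have hq : |c * β + -β * ‖x‖ ^ 2 + ⟪w, x⟫| ≤
      (|β| + ‖w‖ * (1 + c⁻¹)) * (c + ‖x‖ ^ 2) := by
    have e1 : |c * β + -β * ‖x‖ ^ 2| ≤ |β| * (c + ‖x‖ ^ 2) := by
      rw [show c * β + -β * ‖x‖ ^ 2 = β * (c - ‖x‖ ^ 2) by ring, abs_mul]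
      gcongr
      rw [abs_le]
      constructor <;> nlinarith [norm_nonneg x]
    have e2 : |⟪w, x⟫| ≤ ‖w‖ * ((1 + c⁻¹) * (c + ‖x‖ ^ 2)) :=
      (abs_real_inner_le_norm w x).trans (by gcongr; exact norm_le_mul_add_norm_sq hc x)
    calc _ ≤ _ := abs_add_le _ _
      _ ≤ _ := add_le_add e1 e2
      _ = _ := by ring
  calc _ ≤ ((c + ‖x‖ ^ 2) ^ (-(1 / 2 : ℝ))) ^ 3 *
        ((|β| + ‖w‖ * (1 + c⁻¹)) * (c + ‖x‖ ^ 2)) := by gcongr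
    _ = (|β| + ‖w‖ * (1 + c⁻¹)) * (c + ‖x‖ ^ 2) ^ (-(1 / 2 : ℝ)) := by
      linear_combination (|β| + ‖w‖ * (1 + c⁻¹)) * (c + ‖x‖ ^ 2) ^ (-(1 / 2 : ℝ)) * h1
    _ ≤ _ := by gcongr

lemma exists_eq_bubble_kernel {ψ : R3 → ℝ} (hψ : ContDiff ℝ 2 ψ)
    (heq : ∀ x, lap ψ x + 15 * c / (c + ‖x‖ ^ 2) ^ 2 * ψ x = 0)
    (hB : ∀ v n, ∃ B, ∀ r, 1 ≤ r → |moment ψ v n r| ≤ B) :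
    ∃ β w, ∀ x, ψ x = powMulQuad c (-(3 / 2)) (c * β) (-β) w x := by
  have ht : 0 < c ^ (-(3 / 2 : ℝ)) := Real.rpow_pos_of_pos hc _
  set β : ℝ := (c ^ (-(3 / 2 : ℝ)))⁻¹ * c⁻¹ * ψ 0 with hβ
  set w : R3 := (c ^ (-(3 / 2 : ℝ)))⁻¹ • gradient ψ 0 with hw
  have hZ : ContDiff ℝ 2 (powMulQuad c (-(3 / 2)) (c * β) (-β) w) := contDiff_powMulQuad hc _ _ _ _
  refine ⟨β, w, fun x => sub_eq_zero.1 ?_⟩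
  refine eq_zero_of_moment_eq_zero (ψ := fun y => ψ y - powMulQuad c (-(3 / 2)) (c * β) (-β) w y)
    (hψ.continuous.sub hZ.continuous)
    (moment_eq_zero (hψ.sub hZ) hc (fun x => ?_) ?_ ?_ fun v n => ?_) x
  · rw [lap_sub hψ hZ]
    linear_combination heq x - lap_bubble_kernel hc β w x
  · simp [powMulQuad, hβ]
    field_simp
    simp
  · ext v
    rw [fderiv_fun_sub (hψ.differentiable two_ne_zero _) (hZ.differentiable two_ne_zero _), sub_apply,
      fderiv_powMulQuad hc, hw]
    simp [inner_smul_left, gradient, ht.ne']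
  · obtain ⟨B, hB⟩ := hB v n
    refine ⟨B + (|β| + ‖w‖ * (1 + c⁻¹)) * c ^ (-(1 / 2 : ℝ)) * ‖v‖ ^ n *
      sphereMeasure.real Set.univ, fun r hr => ?_⟩
    have hψ0 := hψ.continuous
    have hZ0 := hZ.continuous
    have e : moment (fun y => ψ y - powMulQuad c (-(3 / 2)) (c * β) (-β) w y) v n r =
        moment ψ v n r - moment (powMulQuad c (-(3 / 2)) (c * β) (-β) w) v n r := by
      simp only [moment, sub_mul]
      exact integral_sub (integrable_sphere_of_continuous (by fun_prop))
        (integrable_sphere_of_continuous (by fun_prop))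
    rw [e]
    exact (abs_sub _ _).trans (add_le_add (hB r hr)
      (abs_moment_le (bubble_kernel_bounded hc β w) v n r))

end bubble

section bubbleIntegrals

variable {c : ℝ} (hc : 0 < c)
include hc

lemma integrable_of_abs_le_div_sq {f : R3 → ℝ} (hf : Continuous f) {C : ℝ}
    (h : ∀ x, |f x| ≤ C / (c + ‖x‖ ^ 2) ^ 2) : Integrable f := by
  have h1 : Integrable fun x : R3 => (1 + ‖x‖ ^ 2) ^ (-(4 : ℝ) / 2) :=
    integrable_rpow_neg_one_add_norm_sq (by rw [finrank_R3]; norm_num)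
  have hC : 0 ≤ C := by
    have := (abs_nonneg _).trans (h 0)
    by_contra! hlt
    exact this.not_gt (div_neg_of_neg_of_pos hlt (by positivity))
  refine (h1.const_mul (C * (1 + c⁻¹) ^ 2)).mono' hf.aestronglyMeasurable
    (.of_forall fun x => (h x).trans ?_)
  rw [show (-(4 : ℝ) / 2) = -(2 : ℕ) by norm_num, Real.rpow_neg (by positivity), Real.rpow_natCast,
    ← div_eq_mul_inv, div_le_div_iff₀ (by positivity) (by positivity), mul_assoc, ← mul_pow]
  gcongr
  have h2 : c⁻¹ * c = 1 := inv_mul_cancel₀ hc.ne'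
  have h3 : 0 ≤ c⁻¹ * ‖x‖ ^ 2 := by positivity
  nlinarith

lemma integrable_radial_and_integral_eq_zero :
    Integrable (fun x : R3 => ‖x‖ ^ 2 * (‖x‖ ^ 2 - 5 * c) / (c + ‖x‖ ^ 2) ^ 4) ∧
      ∫ x : R3, ‖x‖ ^ 2 * (‖x‖ ^ 2 - 5 * c) / (c + ‖x‖ ^ 2) ^ 4 = 0 := by
  have hi : Integrable fun x : R3 => ‖x‖ ^ 2 * (‖x‖ ^ 2 - 5 * c) / (c + ‖x‖ ^ 2) ^ 4 := by
    refine integrable_of_abs_le_div_sq hc (C := 5) (Continuous.div (by fun_prop) (by fun_prop)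
      fun x => by positivity) fun x => ?_
    have hm : 0 < c + ‖x‖ ^ 2 := by positivity
    rw [abs_div, abs_of_pos (pow_pos hm 4), div_le_div_iff₀ (by positivity) (by positivity), abs_mul,
      abs_of_nonneg (sq_nonneg ‖x‖)]
    have h1 : |‖x‖ ^ 2 - 5 * c| ≤ 5 * (c + ‖x‖ ^ 2) := by
      rw [abs_le]
      constructor <;> nlinarith [norm_nonneg x]
    have h2 : ‖x‖ ^ 2 ≤ c + ‖x‖ ^ 2 := by linarith
    calc _ ≤ (c + ‖x‖ ^ 2) * (5 * (c + ‖x‖ ^ 2)) * (c + ‖x‖ ^ 2) ^ 2 := by gcongr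
      _ = _ := by ring
  refine ⟨hi, ?_⟩
  obtain ⟨hpi, hp⟩ := polar_coordinates hi
  rw [hp]
  have hm : ∀ r : ℝ, 0 < c + r ^ 2 := fun r => by positivity
  have hn : ∀ r ∈ Set.Ioi (0 : ℝ), r ^ 2 * (∫ ω, ‖r • (ω : R3)‖ ^ 2 *
      (‖r • (ω : R3)‖ ^ 2 - 5 * c) / (c + ‖r • (ω : R3)‖ ^ 2) ^ 4 ∂sphereMeasure) =
      sphereMeasure.real Set.univ * (r ^ 4 * (r ^ 2 - 5 * c) / (c + r ^ 2) ^ 4) := by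
    intro r (hr : 0 < r)
    simp only [norm_smul, norm_eq_of_mem_sphere, mul_one, Real.norm_eq_abs, sq_abs, integral_const,
      smul_eq_mul]
    ring
  rw [integrableOn_congr_fun hn measurableSet_Ioi] at hpi
  rw [setIntegral_congr_fun measurableSet_Ioi hn]
  have hd : ∀ r : ℝ, HasDerivAt
      (fun r => sphereMeasure.real Set.univ * (-(r ^ 5) / (c + r ^ 2) ^ 3))
      (sphereMeasure.real Set.univ * (r ^ 4 * (r ^ 2 - 5 * c) / (c + r ^ 2) ^ 4)) r := by
    intro r
    have h1 : HasDerivAt (fun r : ℝ => c + r ^ 2) (2 * r) r := by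
      simpa using (hasDerivAt_pow 2 r).const_add c
    refine HasDerivAt.const_mul _ (((hasDerivAt_pow 5 r).neg.div (h1.pow 3)
      (pow_ne_zero 3 (hm r).ne')).congr_deriv ?_)
    have := (hm r).ne'
    simp only [Pi.neg_apply, Pi.pow_apply]
    push_cast
    field_simp
    ring
  have hlim : Filter.Tendsto (fun r => sphereMeasure.real Set.univ * (-(r ^ 5) / (c + r ^ 2) ^ 3))
      Filter.atTop (nhds 0) := by
    rw [← mul_zero (sphereMeasure.real Set.univ)]
    refine Filter.Tendsto.const_mul _ (squeeze_zero_norm' ?_ tendsto_inv_atTop_zero)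
    filter_upwards [Filter.eventually_gt_atTop 0] with r hr
    rw [norm_div, norm_neg, Real.norm_of_nonneg (by positivity), Real.norm_of_nonneg (by positivity),
      ← one_div, div_le_div_iff₀ (pow_pos (hm r) 3) hr, one_mul, ← pow_succ]
    calc r ^ 6 = (r ^ 2) ^ 3 := by ring
      _ ≤ _ := by gcongr; linarith
  rw [integral_Ioi_of_hasDerivAt_of_tendsto' (fun r _ => hd r) hpi hlim]
  simp

lemma gradient_bubble (x : R3) :
    gradient (powMulQuad c (-(1 / 2)) 1 0 0) x = (-((c + ‖x‖ ^ 2) ^ (-(1 / 2 : ℝ))) ^ 3) • x := by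
  obtain ⟨h3, -⟩ := rpow_neg_half_pow (m := c + ‖x‖ ^ 2) (by positivity)
  rw [gradient_powMulQuad hc, show (-(1 / 2) - 1 : ℝ) = -(3 / 2) by norm_num, h3]
  simp

lemma integrable_norm_gradient_bubble_sq :
    Integrable fun x : R3 => ‖gradient (powMulQuad c (-(1 / 2)) 1 0 0) x‖ ^ 2 := by
  have hcd : ContDiff ℝ 1 (powMulQuad c (-(1 / 2)) 1 0 0) := contDiff_powMulQuad hc _ _ _ _
  have h1 := hcd.continuous_fderiv one_ne_zero
  refine integrable_of_abs_le_div_sq hc (C := 1) ?_ fun x => ?_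
  · simp only [norm_gradient_eq_norm_fderiv]
    fun_prop
  · have hm : 0 < c + ‖x‖ ^ 2 := by positivity
    obtain ⟨-, -, -, h⟩ := rpow_neg_half_pow hm
    rw [gradient_bubble hc, norm_smul, abs_of_nonneg (by positivity), mul_pow, Real.norm_eq_abs, sq_abs,
      le_div_iff₀ (by positivity)]
    set t := (c + ‖x‖ ^ 2) ^ (-(1 / 2 : ℝ))
    have h2 : (-t ^ 3) ^ 2 * ‖x‖ ^ 2 * (c + ‖x‖ ^ 2) ^ 2 = t ^ 2 * ‖x‖ ^ 2 := by
      linear_combination t ^ 2 * ‖x‖ ^ 2 * (t ^ 2 * (c + ‖x‖ ^ 2) + 1) * h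
    rw [h2, ← h]
    gcongr
    linarith

lemma inner_gradient_bubble_kernel (β : ℝ) (w x : R3) :
    ⟪gradient (powMulQuad c (-(1 / 2)) 1 0 0) x,
      gradient (powMulQuad c (-(3 / 2)) (c * β) (-β) w) x⟫ =
    -β * (‖x‖ ^ 2 * (‖x‖ ^ 2 - 5 * c) / (c + ‖x‖ ^ 2) ^ 4) +
      (2 * ‖x‖ ^ 2 - c) / (c + ‖x‖ ^ 2) ^ 4 * ⟪w, x⟫ := by
  have hm : 0 < c + ‖x‖ ^ 2 := by positivity
  obtain ⟨h3, h5, h7, h1⟩ := rpow_neg_half_pow hm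
  have hm4 : 1 / (c + ‖x‖ ^ 2) ^ 4 = ((c + ‖x‖ ^ 2) ^ (-(1 / 2 : ℝ))) ^ 8 := by
    rw [div_eq_iff (by positivity), eq_comm]
    calc _ = (((c + ‖x‖ ^ 2) ^ (-(1 / 2 : ℝ))) ^ 2 * (c + ‖x‖ ^ 2)) ^ 4 := by ring
      _ = 1 := by rw [h1, one_pow]
  rw [gradient_bubble hc, gradient_powMulQuad hc, show (-(3 / 2) - 1 : ℝ) = -(5 / 2) by norm_num, h3, h5,
    inner_smul_left, inner_add_right, inner_smul_right, inner_smul_right, real_inner_self_eq_norm_sq,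
    real_inner_comm w x, RCLike.conj_to_real,
    div_eq_mul_one_div (‖x‖ ^ 2 * _), div_eq_mul_one_div (2 * ‖x‖ ^ 2 - c), hm4]
  generalize (c + ‖x‖ ^ 2) ^ (-(1 / 2 : ℝ)) = t at *
  linear_combination (-2 * β * ‖x‖ ^ 2 * t ^ 6 + ⟪w, x⟫ * t ^ 6) * h1

lemma integrable_inner_gradient_bubble_kernel (β : ℝ) (w : R3) :
    Integrable (fun x : R3 => ⟪gradient (powMulQuad c (-(1 / 2)) 1 0 0) x,
      gradient (powMulQuad c (-(3 / 2)) (c * β) (-β) w) x⟫) ∧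
    ∫ x : R3, ⟪gradient (powMulQuad c (-(1 / 2)) 1 0 0) x,
      gradient (powMulQuad c (-(3 / 2)) (c * β) (-β) w) x⟫ = 0 := by
  obtain ⟨hr, hr0⟩ := integrable_radial_and_integral_eq_zero hc
  have ho : Integrable fun x : R3 => (2 * ‖x‖ ^ 2 - c) / (c + ‖x‖ ^ 2) ^ 4 * ⟪w, x⟫ := by
    refine integrable_of_abs_le_div_sq hc (C := 2 * (‖w‖ * (1 + c⁻¹)))
      ((Continuous.div (by fun_prop) (by fun_prop) fun x => by positivity).mul (by fun_prop))
      fun x => ?_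
    have hm : 0 < c + ‖x‖ ^ 2 := by positivity
    have e1 : |2 * ‖x‖ ^ 2 - c| ≤ 2 * (c + ‖x‖ ^ 2) := by
      rw [abs_le]
      constructor <;> nlinarith [norm_nonneg x]
    have e2 : |⟪w, x⟫| ≤ ‖w‖ * ((1 + c⁻¹) * (c + ‖x‖ ^ 2)) :=
      (abs_real_inner_le_norm w x).trans (by gcongr; exact norm_le_mul_add_norm_sq hc x)
    rw [abs_mul, abs_div, abs_of_pos (pow_pos hm 4)]
    calc _ ≤ 2 * (c + ‖x‖ ^ 2) / (c + ‖x‖ ^ 2) ^ 4 * (‖w‖ * ((1 + c⁻¹) * (c + ‖x‖ ^ 2))) := by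
            gcongr
      _ = _ := by field_simp
  simp only [inner_gradient_bubble_kernel hc]
  refine ⟨(hr.const_mul _).add ho, ?_⟩
  rw [integral_add (hr.const_mul _) ho, integral_const_mul, hr0, mul_zero, zero_add]
  have h := integral_neg_eq_self
    (fun x : R3 => (2 * ‖x‖ ^ 2 - c) / (c + ‖x‖ ^ 2) ^ 4 * ⟪w, x⟫) volume
  simp only [norm_neg, inner_neg_right, mul_neg, integral_neg] at h
  linarith

end bubbleIntegrals

lemma gradient_const_mul {f : R3 → ℝ} (hf : Differentiable ℝ f) (a : ℝ) (x : R3) :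
    gradient (fun y => a * f y) x = a • gradient f x := by
  rw [gradient, gradient, fderiv_const_mul (hf x), map_smul]

lemma gradient_add {f g : R3 → ℝ} (hf : Differentiable ℝ f) (hg : Differentiable ℝ g) (x : R3) :
    gradient (fun y => f y + g y) x = gradient f x + gradient g x := by
  rw [gradient, gradient, gradient, fderiv_fun_add (hf x) (hg x), map_add]

lemma Qb_inv_smul {s : ℝ} (hs : 0 < s) (x : R3) :
    Qb (s⁻¹ • x) = 3 ^ (1 / 4 : ℝ) * s * powMulQuad (s ^ 2) (-(1 / 2)) 1 0 0 x := by
  have h : 1 + ‖s⁻¹ • x‖ ^ 2 = (s ^ 2)⁻¹ * (s ^ 2 + ‖x‖ ^ 2) := by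
    rw [norm_smul, norm_inv, Real.norm_of_nonneg hs.le]
    field_simp
  have h2 : ((s ^ 2)⁻¹) ^ (-(1 / 2) : ℝ) = s := by
    rw [Real.inv_rpow (by positivity), Real.rpow_neg (by positivity), inv_inv, ← Real.sqrt_eq_rpow,
      Real.sqrt_sq hs.le]
  rw [Qb, h, show (-(1 : ℝ) / 2) = -(1 / 2) by norm_num,
    Real.mul_rpow (by positivity) (by positivity), h2, powMulQuad, inner_zero_left]
  ring

lemma integral_norm_gradient_inv_smul_sq {f : R3 → ℝ} {s : ℝ} (hs : 0 < s) :
    ∫ x : R3, ‖gradient (fun y => f (s⁻¹ • y)) x‖ ^ 2 = s * ∫ x : R3, ‖gradient f x‖ ^ 2 := by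
  simp only [norm_gradient_eq_norm_fderiv]
  have h : ∀ x : R3, ‖fderiv ℝ (fun y => f (s⁻¹ • y)) x‖ ^ 2 =
      (s⁻¹) ^ 2 * ‖fderiv ℝ f (s⁻¹ • x)‖ ^ 2 := by
    intro x
    rw [fderiv_comp_smul, norm_smul, mul_pow, Real.norm_eq_abs, sq_abs]
  simp only [h]
  rw [integral_const_mul, Measure.integral_comp_smul volume (fun x => ‖fderiv ℝ f x‖ ^ 2),
    finrank_R3, abs_of_pos (by positivity), smul_eq_mul]
  field_simp

section scaledBubble

variable {c : ℝ} (hc : 0 < c) (K : ℝ)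
include hc

lemma integrable_inner_gradient_scaled_bubble_kernel (β : ℝ) (w : R3) :
    Integrable (fun x : R3 => ⟪gradient (fun y => K * powMulQuad c (-(1 / 2)) 1 0 0 y) x,
      gradient (powMulQuad c (-(3 / 2)) (c * β) (-β) w) x⟫) ∧
    ∫ x : R3, ⟪gradient (fun y => K * powMulQuad c (-(1 / 2)) 1 0 0 y) x,
      gradient (powMulQuad c (-(3 / 2)) (c * β) (-β) w) x⟫ = 0 := by
  have hd : Differentiable ℝ (powMulQuad c (-(1 / 2)) 1 0 0) :=
    (contDiff_powMulQuad hc _ _ _ _ (n := 1)).differentiable one_ne_zero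
  obtain ⟨h1, h2⟩ := integrable_inner_gradient_bubble_kernel hc β w
  simp only [gradient_const_mul hd, inner_smul_left]
  exact ⟨h1.const_mul _, by rw [integral_const_mul, h2, mul_zero]⟩

lemma scaled_bubble_generators (l₀ l₁ l₂ l₃ : ℝ) (x : R3) :
    l₀ * (K * powMulQuad c (-(1 / 2)) 1 0 0 x / 2 +
        ⟪x, gradient (fun y => K * powMulQuad c (-(1 / 2)) 1 0 0 y) x⟫)
      + l₁ * fderiv ℝ (fun y => K * powMulQuad c (-(1 / 2)) 1 0 0 y) x (EuclideanSpace.single 0 1)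
      + l₂ * fderiv ℝ (fun y => K * powMulQuad c (-(1 / 2)) 1 0 0 y) x (EuclideanSpace.single 1 1)
      + l₃ * fderiv ℝ (fun y => K * powMulQuad c (-(1 / 2)) 1 0 0 y) x (EuclideanSpace.single 2 1) =
    powMulQuad c (-(3 / 2)) (c * (l₀ * K / 2)) (-(l₀ * K / 2)) (-K • !₂[l₁, l₂, l₃]) x := by
  have hd : Differentiable ℝ (powMulQuad c (-(1 / 2)) 1 0 0) :=
    (contDiff_powMulQuad hc _ _ _ _ (n := 1)).differentiable one_ne_zero
  have hm : 0 < c + ‖x‖ ^ 2 := by positivity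
  obtain ⟨h3, -, -, h1⟩ := rpow_neg_half_pow hm
  have hx : ⟪!₂[l₁, l₂, l₃], x⟫ = l₁ * x 0 + l₂ * x 1 + l₃ * x 2 := by
    simp [PiLp.inner_apply, Fin.sum_univ_three]
    ring
  have hi : ∀ i : Fin 3, ⟪x, EuclideanSpace.single i (1 : ℝ)⟫ = x i := by
    simp [PiLp.inner_apply]
  rw [gradient_const_mul hd, gradient_bubble hc, fderiv_const_mul (hd x)]
  simp only [smul_apply, smul_eq_mul, fderiv_powMulQuad hc, hi,
    show (-(1 / 2) - 1 : ℝ) = -(3 / 2) by norm_num, powMulQuad, inner_smul_left, inner_smul_right,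
    inner_zero_left, RCLike.conj_to_real, hx, h3, real_inner_self_eq_norm_sq]
  generalize (c + ‖x‖ ^ 2) ^ (-(1 / 2 : ℝ)) = t at *
  linear_combination (-l₀ * K * t / 2) * h1

/-- The linearized equation around the scaled bubble, for functions of finite energy. -/
lemma eq_kernel_of_linearized (hK : K ^ 4 = 3 * c ^ 2) {b : ℝ}
    (hb : b * (∫ y : R3, ‖gradient (fun y => K * powMulQuad c (-(1 / 2)) 1 0 0 y) y‖ ^ 2) < c)
    {φ : R3 → ℝ} (hφ : ContDiff ℝ 2 φ) (hφi : Integrable fun x : R3 => ‖gradient φ x‖ ^ 2)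
    (h : ∀ x, -(c * lap φ x)
        - 2 * b * (∫ y : R3, ⟪gradient (fun y => K * powMulQuad c (-(1 / 2)) 1 0 0 y) y,
            gradient φ y⟫) * lap (fun y => K * powMulQuad c (-(1 / 2)) 1 0 0 y) x
        - 5 * (K * powMulQuad c (-(1 / 2)) 1 0 0 x) ^ 4 * φ x = 0) :
    ∃ β w, φ = powMulQuad c (-(3 / 2)) (c * β) (-β) w := by
  set u : R3 → ℝ := fun y => K * powMulQuad c (-(1 / 2)) 1 0 0 y with hu
  set E := ∫ y : R3, ‖gradient u y‖ ^ 2 with hE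
  set T := ∫ y : R3, ⟪gradient u y, gradient φ y⟫ with hT
  have hB : ContDiff ℝ 2 (powMulQuad c (-(1 / 2)) 1 0 0) := contDiff_powMulQuad hc _ _ _ _
  have hucd : ContDiff ℝ 2 u := contDiff_const.mul hB
  have hBd := hB.differentiable two_ne_zero
  have hud := hucd.differentiable two_ne_zero
  set α := b * T / (2 * c) with hα
  have hlap : ∀ x, lap (fun y => φ y - α * u y) x +
      15 * c / (c + ‖x‖ ^ 2) ^ 2 * (φ x - α * u x) = 0 := by
    intro x
    have hm : 0 < c + ‖x‖ ^ 2 := by positivity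
    obtain ⟨-, -, -, h1⟩ := rpow_neg_half_pow hm
    have hx := h x
    have h2 : 15 * c / (c + ‖x‖ ^ 2) ^ 2 = 15 * c * ((c + ‖x‖ ^ 2) ^ (-(1 / 2 : ℝ))) ^ 4 := by
      rw [div_eq_iff (by positivity)]
      linear_combination
        (-15 * c * (((c + ‖x‖ ^ 2) ^ (-(1 / 2 : ℝ))) ^ 2 * (c + ‖x‖ ^ 2) + 1)) * h1
    have hBx : powMulQuad c (-(1 / 2)) 1 0 0 x = (c + ‖x‖ ^ 2) ^ (-(1 / 2 : ℝ)) := by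
      simp [powMulQuad]
    rw [lap_sub hφ (contDiff_const.mul hucd), lap_const_mul hucd, h2]
    rw [show u x = K * powMulQuad c (-(1 / 2)) 1 0 0 x from rfl]
    rw [lap_const_mul hB, lap_bubble hc] at *
    rw [hBx] at hx ⊢
    generalize (c + ‖x‖ ^ 2) ^ (-(1 / 2 : ℝ)) = t at *
    have hαc : 2 * c * α = b * T := by rw [hα]; field_simp
    refine mul_left_cancel₀ hc.ne' ?_
    linear_combination -hx - 5 * t ^ 4 * φ x * hK - 6 * c * K * t ^ 5 * hαc
  obtain ⟨β, w, hψ⟩ := exists_eq_bubble_kernel hc (hφ.sub (contDiff_const.mul hucd)) hlap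
    fun v n => by
      obtain ⟨B, hB⟩ := exists_abs_moment_le (hφ.of_le (by norm_num)) hφi v n
      have hbd : ∀ x, |α * u x| ≤ |α| * (|K| * c ^ (-(1 / 2 : ℝ))) := fun x => by
        rw [hu, abs_mul, abs_mul]
        gcongr
        exact bubble_bounded hc x
      refine ⟨B + |α| * (|K| * c ^ (-(1 / 2 : ℝ))) * ‖v‖ ^ n * sphereMeasure.real Set.univ,
        fun r hr => ?_⟩
      have hφ0 := hφ.continuous
      have hu0 := hucd.continuous
      have e : moment (fun y => φ y - α * u y) v n r =
          moment φ v n r - moment (fun y => α * u y) v n r := by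
        simp only [moment, sub_mul]
        exact integral_sub (integrable_sphere_of_continuous (by fun_prop))
          (integrable_sphere_of_continuous (by fun_prop))
      rw [e]
      exact (abs_sub _ _).trans (add_le_add (hB r hr) (abs_moment_le hbd v n r))
  set Z := powMulQuad c (-(3 / 2)) (c * β) (-β) w with hZ
  have hZd : Differentiable ℝ Z :=
    (contDiff_powMulQuad hc _ _ _ _ (n := 1)).differentiable one_ne_zero
  have hφeq : φ = fun y => α * u y + Z y := by
    ext y
    linear_combination hψ y
  have hTeq : T = α * E := by
    obtain ⟨h1, h2⟩ := integrable_inner_gradient_scaled_bubble_kernel hc K β w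
    have h3 : Integrable fun x : R3 => ‖gradient u x‖ ^ 2 := by
      simp only [hu, gradient_const_mul hBd, norm_smul, mul_pow]
      exact (integrable_norm_gradient_bubble_sq hc).const_mul _
    have e : ∀ y : R3, ⟪gradient u y, gradient φ y⟫ =
        α * ‖gradient u y‖ ^ 2 + ⟪gradient u y, gradient Z y⟫ := by
      intro y
      rw [hφeq, gradient_add (hud.const_mul α) hZd, gradient_const_mul hud, inner_add_right,
        inner_smul_right, real_inner_self_eq_norm_sq]
    rw [hT]
    simp only [e]
    rw [integral_add (h3.const_mul _) h1, integral_const_mul, h2, add_zero]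
  have hT0 : T = 0 := by
    by_contra hne
    have h1 : 2 * c * T = b * E * T := by
      calc 2 * c * T = (2 * c * α) * E := by rw [hTeq]; ring
        _ = _ := by rw [hα]; field_simp
    have h2 := mul_right_cancel₀ hne h1
    linarith
  refine ⟨β, w, ?_⟩
  rw [hφeq, hα, hT0]
  ext y
  simp [hZ]

end scaledBubble

/-- nondegeneracy: let `u(x) = Q(x/√c)` with `√c = (bk + √(b²k² + 4a))/2`,
`k = ∫|∇Q|²`, be the positive radial solution of the Kirchhoff equation, and let
`L₊φ = -(a + b∫|∇u|²)Δφ - 2b(∫∇u·∇φ)Δu - 5u⁴φ` be the linearized operator at `u`. Then every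
finite-energy `C²` solution of `L₊φ = 0` is a linear combination of `u/2 + x·∇u` and the
partial derivatives `uₓ₁, uₓ₂, uₓ₃`, and conversely each such linear combination satisfies
`L₊φ = 0`: that is, `Ker L₊ = span{uₓ₁, uₓ₂, uₓ₃, u/2 + x·∇u}`. -/
theorem kirchhoff_nondegeneracy (a b : ℝ) (ha : 0 < a) (hb : 0 < b)
    (k : ℝ) (hk : k = ∫ x : R3, ‖gradient Qb x‖ ^ 2)
    (sc : ℝ) (hsc : sc = (b * k + Real.sqrt (b ^ 2 * k ^ 2 + 4 * a)) / 2)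
    (u : R3 → ℝ) (hu : ∀ x, u x = Qb (sc⁻¹ • x)) :
    (∀ φ : R3 → ℝ, ContDiff ℝ 2 φ →
      Integrable (fun x : R3 => ‖gradient φ x‖ ^ 2) →
      (∀ x, -((a + b * ∫ y : R3, ‖gradient u y‖ ^ 2) * lap φ x)
        - 2 * b * (∫ y : R3, ⟪gradient u y, gradient φ y⟫) * lap u x
        - 5 * u x ^ 4 * φ x = 0) →
      ∃ l₀ l₁ l₂ l₃ : ℝ, ∀ x,
        φ x = l₀ * (u x / 2 + ⟪x, gradient u x⟫)
          + l₁ * fderiv ℝ u x (EuclideanSpace.single 0 1)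
          + l₂ * fderiv ℝ u x (EuclideanSpace.single 1 1)
          + l₃ * fderiv ℝ u x (EuclideanSpace.single 2 1)) ∧
    (∀ l₀ l₁ l₂ l₃ : ℝ,
      ∀ x, -((a + b * ∫ y : R3, ‖gradient u y‖ ^ 2)
          * lap (fun z => l₀ * (u z / 2 + ⟪z, gradient u z⟫)
            + l₁ * fderiv ℝ u z (EuclideanSpace.single 0 1)
            + l₂ * fderiv ℝ u z (EuclideanSpace.single 1 1)
            + l₃ * fderiv ℝ u z (EuclideanSpace.single 2 1)) x)
        - 2 * b * (∫ y : R3, ⟪gradient u y,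
            gradient (fun z => l₀ * (u z / 2 + ⟪z, gradient u z⟫)
              + l₁ * fderiv ℝ u z (EuclideanSpace.single 0 1)
              + l₂ * fderiv ℝ u z (EuclideanSpace.single 1 1)
              + l₃ * fderiv ℝ u z (EuclideanSpace.single 2 1)) y⟫) * lap u x
        - 5 * u x ^ 4 * (l₀ * (u x / 2 + ⟪x, gradient u x⟫)
            + l₁ * fderiv ℝ u x (EuclideanSpace.single 0 1)
            + l₂ * fderiv ℝ u x (EuclideanSpace.single 1 1)
            + l₃ * fderiv ℝ u x (EuclideanSpace.single 2 1)) = 0) := by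
  have hk0 : 0 ≤ k := hk ▸ integral_nonneg fun _ => sq_nonneg _
  have hsq := Real.sq_sqrt (show 0 ≤ b ^ 2 * k ^ 2 + 4 * a by positivity)
  have hs : 0 < sc := by
    have : 0 < Real.sqrt (b ^ 2 * k ^ 2 + 4 * a) := Real.sqrt_pos.2 (by positivity)
    have : 0 ≤ b * k := by positivity
    linarith
  have hquad : a + b * (sc * k) = sc ^ 2 := by
    rw [hsc]
    linear_combination -hsq / 4
  have hc : 0 < sc ^ 2 := by positivity
  obtain rfl : u = fun y => 3 ^ (1 / 4 : ℝ) * sc * powMulQuad (sc ^ 2) (-(1 / 2)) 1 0 0 y :=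
    funext fun x => (hu x).trans (Qb_inv_smul hs x)
  have hE : ∫ y : R3, ‖gradient (fun y => 3 ^ (1 / 4 : ℝ) * sc *
      powMulQuad (sc ^ 2) (-(1 / 2)) 1 0 0 y) y‖ ^ 2 = sc * k := by
    rw [hk, ← integral_norm_gradient_inv_smul_sq hs]
    simp only [Qb_inv_smul hs]
  have h34 : ((3 : ℝ) ^ (1 / 4 : ℝ)) ^ 4 = 3 := by
    rw [← Real.rpow_natCast, ← Real.rpow_mul (by norm_num)]
    norm_num
  clear hu
  set K := (3 : ℝ) ^ (1 / 4 : ℝ) * sc with hKdef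
  have hK : K ^ 4 = 3 * (sc ^ 2) ^ 2 := by
    rw [hKdef, mul_pow, h34]
    ring
  have hK0 : K ≠ 0 := by positivity
  generalize sc ^ 2 = c at *
  simp only [hE, hquad, scaled_bubble_generators hc]
  refine ⟨fun φ hφ hφi h => ?_, fun l₀ l₁ l₂ l₃ x => ?_⟩
  · obtain ⟨β, w, rfl⟩ := eq_kernel_of_linearized hc K hK (b := b) (by rw [hE]; linarith) hφ hφi h
    refine ⟨2 * β / K, -w 0 / K, -w 1 / K, -w 2 / K, fun x => ?_⟩
    have h1 : 2 * β / K * K / 2 = β := by field_simp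
    have h2 : -K • !₂[-w 0 / K, -w 1 / K, -w 2 / K] = w := by
      ext i
      fin_cases i <;> simp <;> field_simp
    rw [h1, h2]
  · rw [(integrable_inner_gradient_scaled_bubble_kernel hc K _ _).2]
    have h := lap_bubble_kernel hc (l₀ * K / 2) (-K • !₂[l₁, l₂, l₃]) x
    have hm : 0 < c + ‖x‖ ^ 2 := by positivity
    obtain ⟨-, -, -, h1⟩ := rpow_neg_half_pow hm
    have h2 : 5 * (K * powMulQuad c (-(1 / 2)) 1 0 0 x) ^ 4 =
        c * (15 * c / (c + ‖x‖ ^ 2) ^ 2) := by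
      have hBx : powMulQuad c (-(1 / 2)) 1 0 0 x = (c + ‖x‖ ^ 2) ^ (-(1 / 2 : ℝ)) := by
        simp [powMulQuad]
      rw [hBx, mul_pow, hK, mul_div_assoc', eq_div_iff (by positivity)]
      linear_combination (15 * c ^ 2 * (((c + ‖x‖ ^ 2) ^ (-(1 / 2 : ℝ))) ^ 2 *
        (c + ‖x‖ ^ 2) + 1)) * h1
    rw [h2]
    linear_combination -c * h
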